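/- arXiv:1106.1754 — 5 statements merged into one kernel-verified Lean document; each statement's English description precedes it below -/
import Mathlib

section
/- For z in the upper half-plane and Re(s) > 1, the bilateral zeta function ξ₁(s, z | e^{πi}) := Σ_{n≥0} (z + e^{πi} + n e^{πi})^{-s} + Σ_{n≥0} (z + n)^{-s} equals e^{-πis/2} (2π)^s / Γ(s) · Σ_{n≥1} n^{s-1} e^{2πinz}, where complex powers use the principal branch with argument in (-π, π]. -/
open Complex Real

open MeasureTheory Set Filter Topology Asymptotics FourierTransform

/-- The integral `∫ t ^ (a - 1) * exp (-r t)` over `(0, ∞)` is holomorphic in `r` on the right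
half-plane. -/
lemma differentiableAt_integral_cpow_mul_exp_neg_mul {a r : ℂ} (ha : 0 < a.re) (hr : 0 < r.re) :
    DifferentiableAt ℂ
      (fun w : ℂ ↦ ∫ t : ℝ in Ioi 0, (t : ℂ) ^ (a - 1) * Complex.exp (-(w * t))) r := by
  have hmeas (w : ℂ) : AEStronglyMeasurable
      (fun t : ℝ ↦ (t : ℂ) ^ (a - 1) * Complex.exp (-(w * t))) (volume.restrict (Ioi 0)) := by
    refine Measurable.aestronglyMeasurable ?_
    fun_prop
  have hnorm (w : ℂ) {t : ℝ} (ht : 0 < t) :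
      ‖(t : ℂ) ^ (a - 1) * Complex.exp (-(w * t))‖
        = t ^ (a.re - 1) * Real.exp (-w.re * t) := by
    rw [norm_mul, Complex.norm_cpow_eq_rpow_re_of_pos ht, Complex.norm_exp]
    simp
  have hint {b c : ℝ} (hb : -1 < b) (hc : 0 < c) :
      IntegrableOn (fun t : ℝ ↦ t ^ b * Real.exp (-c * t)) (Ioi 0) := by
    simpa using integrableOn_rpow_mul_exp_neg_mul_rpow hb one_pos hc
  refine (hasDerivAt_integral_of_dominated_loc_of_deriv_le
    (F' := fun w t ↦ (t : ℂ) ^ (a - 1) * Complex.exp (-(w * t)) * -(t : ℂ))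
    (bound := fun t ↦ t ^ a.re * Real.exp (-(r.re / 2) * t))
    (s := {w : ℂ | r.re / 2 < w.re}) ?_ ?_ ?_ ?_ ?_ ?_ ?_).2.differentiableAt
  · exact (isOpen_lt continuous_const Complex.continuous_re).mem_nhds (half_lt_self hr)
  · exact Eventually.of_forall hmeas
  · refine (hint (by linarith : -1 < a.re - 1) hr).mono' (hmeas r) ?_
    filter_upwards [ae_restrict_mem measurableSet_Ioi] with t ht
    exact (hnorm r ht).le
  · exact (hmeas r).mul (by fun_prop)
  · filter_upwards [ae_restrict_mem measurableSet_Ioi] with t ht w hw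
    have ht : 0 < t := ht
    have hw : r.re / 2 < w.re := hw
    rw [norm_mul, hnorm w ht, norm_neg, Complex.norm_real, Real.norm_of_nonneg ht.le,
      mul_right_comm, Real.rpow_sub_one ht.ne', div_mul_cancel₀ _ ht.ne']
    gcongr
  · exact hint (by linarith) (half_pos hr)
  · refine Eventually.of_forall fun t w _ ↦ ?_
    have h : HasDerivAt (fun w : ℂ ↦ -(w * t)) (-(t : ℂ)) w :=
      (hasDerivAt_mul_const (t : ℂ)).fun_neg
    simpa [mul_assoc] using h.cexp.const_mul ((t : ℂ) ^ (a - 1))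

/-- The Gamma integral `∫ t ^ (a - 1) * exp (-r t)` with a complex rate `r` of positive real
part. -/
lemma integral_cpow_mul_exp_neg_complex_mul_Ioi {a r : ℂ} (ha : 0 < a.re) (hr : 0 < r.re) :
    ∫ t : ℝ in Ioi 0, (t : ℂ) ^ (a - 1) * Complex.exp (-(r * t))
      = r ^ (-a) * Complex.Gamma a := by
  have hopen : IsOpen {w : ℂ | 0 < w.re} := isOpen_lt continuous_const Complex.continuous_re
  have hl : AnalyticOnNhd ℂ
      (fun w : ℂ ↦ ∫ t : ℝ in Ioi 0, (t : ℂ) ^ (a - 1) * Complex.exp (-(w * t)))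
      {w : ℂ | 0 < w.re} :=
    DifferentiableOn.analyticOnNhd (fun w hw ↦
      (differentiableAt_integral_cpow_mul_exp_neg_mul ha hw).differentiableWithinAt) hopen
  have hr' : AnalyticOnNhd ℂ (fun w : ℂ ↦ w ^ (-a) * Complex.Gamma a) {w : ℂ | 0 < w.re} :=
    DifferentiableOn.analyticOnNhd (fun w hw ↦
      ((differentiableAt_id.cpow_const (Or.inl hw)).mul_const _).differentiableWithinAt) hopen
  have hreal {x : ℝ} (hx : 0 < x) :
      ∫ t : ℝ in Ioi 0, (t : ℂ) ^ (a - 1) * Complex.exp (-((x : ℂ) * t))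
        = (x : ℂ) ^ (-a) * Complex.Gamma a := by
    rw [Complex.integral_cpow_mul_exp_neg_mul_Ioi ha hx, one_div, Complex.cpow_neg,
      Complex.inv_cpow]
    rw [Complex.arg_ofReal_of_nonneg hx.le]
    exact Real.pi_pos.ne
  refine hl.eqOn_of_preconnected_of_frequently_eq hr'
    (convex_halfSpace_re_gt 0).isPreconnected (z₀ := 1) (by simp) ?_ hr
  have htend : Tendsto (fun x : ℝ ↦ (x : ℂ)) (𝓝[>] 1) (𝓝[≠] 1) := by
    refine tendsto_nhdsWithin_iff.2 ⟨?_, ?_⟩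
    · exact (Complex.continuous_ofReal.tendsto' 1 1 (by simp)).mono_left nhdsWithin_le_nhds
    · filter_upwards [self_mem_nhdsWithin] with x hx
      simpa using (ne_of_gt hx : x ≠ 1)
  refine htend.frequently (Eventually.frequently ?_)
  filter_upwards [self_mem_nhdsWithin] with x hx
  exact hreal (zero_lt_one.trans hx)

/-- Rotating the upper half-plane onto the right half-plane inside a complex power. -/
lemma neg_two_pi_I_mul_cpow {w : ℂ} (hw : 0 < w.im) (s : ℂ) :
    (-(2 * π * I) * w) ^ (-s)
      = (2 * π : ℂ) ^ (-s) * Complex.exp (π * I * s / 2) * w ^ (-s) := by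
  have hw0 : w ≠ 0 := by rintro rfl; simp at hw
  have hlog : Complex.log (-I * w) = Complex.log (-I) + Complex.log w := by
    refine Complex.log_mul (by simp) hw0 ?_
    have h0 := Complex.arg_nonneg_iff.2 hw.le
    have h1 := Complex.arg_le_pi w
    rw [Complex.arg_neg_I]
    constructor <;> linarith [Real.pi_pos]
  have hmul : -(2 * π * I) * w = ((2 * π : ℝ) : ℂ) * (-I * w) := by push_cast; ring
  have hcast : (2 * π : ℂ) = ((2 * π : ℝ) : ℂ) := by push_cast; rfl
  have h2pi : ((2 * π : ℝ) : ℂ) ≠ 0 := by exact_mod_cast Real.two_pi_pos.ne'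
  have hIw : -I * w ≠ 0 := mul_ne_zero (by simp) hw0
  rw [hmul, hcast, Complex.cpow_def_of_ne_zero (mul_ne_zero h2pi hIw),
    Complex.log_ofReal_mul Real.two_pi_pos hIw, hlog, Complex.log_neg_I,
    Complex.cpow_def_of_ne_zero h2pi, Complex.cpow_def_of_ne_zero hw0, ← Complex.exp_add,
    ← Complex.exp_add, Complex.ofReal_log Real.two_pi_pos.le]
  congr 1
  ring

lemma summable_int_add_cpow_neg (z : ℂ) {s : ℂ} (hs : 1 < s.re) :
    Summable fun n : ℤ ↦ (z + n) ^ (-s) := by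
  refine summable_of_isBigO (Real.summable_abs_int_rpow hs) ?_
  have hpow : (fun n : ℤ ↦ (z + n) ^ (-s)) =O[cofinite] fun n : ℤ ↦ ‖(z + n)⁻¹‖ ^ s.re := by
    refine IsBigO.of_bound (Real.exp (π * |s.im|)) (Eventually.of_forall fun n ↦ ?_)
    refine (Complex.norm_cpow_le _ _).trans ?_
    rw [Real.norm_of_nonneg (by positivity), norm_inv, Real.inv_rpow (norm_nonneg _),
      Complex.neg_re, Real.rpow_neg (norm_nonneg _), div_eq_mul_inv, ← Real.exp_neg, mul_comm]
    gcongr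
    rw [Complex.neg_im, mul_neg, neg_neg]
    refine (le_abs_self _).trans ?_
    rw [abs_mul]
    gcongr
    exact Complex.abs_arg_le_pi _
  have hinv : (fun n : ℤ ↦ ‖(z + n)⁻¹‖) =O[cofinite] fun n : ℤ ↦ |(n : ℝ)|⁻¹ := by
    simpa using (EisensteinSeries.linear_inv_isBigO_right 1 z).norm_norm
  refine hpow.trans ((hinv.rpow (by linarith)
    (Eventually.of_forall fun n ↦ by positivity)).congr_right fun n ↦ ?_)
  rw [Real.inv_rpow (abs_nonneg _), Real.rpow_neg (abs_nonneg _)]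

/-- The function `t ↦ t ^ (s - 1) * exp (2πizt)` on `(0, ∞)`, extended by zero when `1 < s.re`. -/
noncomputable def lipschitzKernel (z s : ℂ) (t : ℝ) : ℂ :=
  ((max t 0 : ℝ) : ℂ) ^ (s - 1) * Complex.exp (2 * π * I * z * t)

section lipschitzKernel

variable {z s : ℂ}

lemma lipschitzKernel_of_nonpos (hs : 1 < s.re) {t : ℝ} (ht : t ≤ 0) :
    lipschitzKernel z s t = 0 := by
  have : s - 1 ≠ 0 := fun h ↦ by
    have := congrArg Complex.re h
    simp at this
    linarith
  simp [lipschitzKernel, max_eq_right ht, Complex.zero_cpow this]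

lemma lipschitzKernel_of_pos {t : ℝ} (ht : 0 < t) :
    lipschitzKernel z s t = (t : ℂ) ^ (s - 1) * Complex.exp (2 * π * I * z * t) := by
  rw [lipschitzKernel, max_eq_left ht.le]

lemma continuous_lipschitzKernel (hs : 1 < s.re) : Continuous (lipschitzKernel z s) := by
  have h : Continuous fun x : ℝ ↦ (x : ℂ) ^ (s - 1) :=
    Complex.continuous_ofReal_cpow_const (by simpa using hs)
  exact (h.comp (continuous_id.max continuous_const)).mul (by fun_prop)

lemma lipschitzKernel_isBigO (hz : 0 < z.im) (hs : 1 < s.re) :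
    lipschitzKernel z s =O[cocompact ℝ] fun x : ℝ ↦ |x| ^ (-2 : ℝ) := by
  rw [cocompact_eq_atBot_atTop, isBigO_sup]
  constructor
  · refine IsBigO.of_bound 0 ?_
    filter_upwards [eventually_le_atBot 0] with t ht
    simp [lipschitzKernel_of_nonpos hs ht]
  · have hexp := (isLittleO_exp_neg_mul_rpow_atTop (mul_pos Real.two_pi_pos hz)
      (-1 - s.re)).isBigO
    have hmul := (isBigO_refl (fun t : ℝ ↦ t ^ (s.re - 1)) atTop).mul hexp
    refine (IsBigO.of_norm_eventuallyLE ?_).trans (hmul.congr' EventuallyEq.rfl ?_)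
    · filter_upwards [eventually_gt_atTop 0] with t ht
      rw [lipschitzKernel_of_pos ht, norm_mul, Complex.norm_cpow_eq_rpow_re_of_pos ht,
        Complex.norm_exp]
      simp
    · filter_upwards [eventually_gt_atTop 0] with t ht
      rw [← Real.rpow_add ht, abs_of_pos ht]
      congr 1
      ring

lemma fourier_lipschitzKernel (hz : 0 < z.im) (hs : 1 < s.re) (x : ℝ) :
    𝓕 (lipschitzKernel z s) x
      = (2 * π : ℂ) ^ (-s) * Complex.exp (π * I * s / 2) * Complex.Gamma s
        * (z - x) ^ (-s) := by
  have hre : 0 < (-(2 * π * I) * (z - x)).re := by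
    have : 0 < 2 * π * z.im := mul_pos Real.two_pi_pos hz
    simpa using this
  have hsupp : ∫ t : ℝ, Complex.exp (↑(-2 * π * t * x) * I) • lipschitzKernel z s t
      = ∫ t : ℝ in Ioi 0, Complex.exp (↑(-2 * π * t * x) * I) • lipschitzKernel z s t := by
    refine (setIntegral_eq_integral_of_forall_compl_eq_zero fun t ht ↦ ?_).symm
    rw [lipschitzKernel_of_nonpos hs (not_lt.1 ht), smul_zero]
  rw [Real.fourier_real_eq_integral_exp_smul, hsupp]
  calc
    _ = ∫ t : ℝ in Ioi 0, (t : ℂ) ^ (s - 1) * Complex.exp (-(-(2 * π * I) * (z - x) * t)) := by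
      refine setIntegral_congr_fun measurableSet_Ioi fun t ht ↦ ?_
      simp only [lipschitzKernel_of_pos ht, smul_eq_mul]
      rw [mul_left_comm, ← Complex.exp_add]
      congr 2
      push_cast
      ring
    _ = _ := by
      rw [integral_cpow_mul_exp_neg_complex_mul_Ioi (by linarith) hre,
        neg_two_pi_I_mul_cpow (by simpa using hz)]
      ring

end lipschitzKernel

/-- **Lipschitz summation formula**, before solving for the sum over the integers. -/
lemma tsum_cpow_mul_exp_eq_tsum_int {z s : ℂ} (hz : 0 < z.im) (hs : 1 < s.re) :
    ∑' n : ℕ, ((n : ℂ) + 1) ^ (s - 1) * Complex.exp (2 * π * I * ((n : ℂ) + 1) * z)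
      = (2 * π : ℂ) ^ (-s) * Complex.exp (π * I * s / 2) * Complex.Gamma s
        * ∑' n : ℤ, (z + n) ^ (-s) := by
  have hsum : Summable fun n : ℤ ↦ 𝓕 (lipschitzKernel z s) n := by
    simp_rw [fourier_lipschitzKernel hz hs]
    refine Summable.mul_left _ ?_
    simpa [Function.comp_def, sub_eq_add_neg] using
      (Equiv.neg ℤ).summable_iff.2 (summable_int_add_cpow_neg z hs)
  have hpoisson := Real.tsum_eq_tsum_fourier_of_rpow_decay_of_summable
    (continuous_lipschitzKernel hs) one_lt_two (lipschitzKernel_isBigO hz hs) hsum 0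
  have hleft : ∑' n : ℤ, lipschitzKernel z s n
      = ∑' n : ℕ, ((n : ℂ) + 1) ^ (s - 1) * Complex.exp (2 * π * I * ((n : ℂ) + 1) * z) := by
    have hinj : Function.Injective fun n : ℕ ↦ (n : ℤ) + 1 := fun a b h ↦ by simpa using h
    rw [← hinj.tsum_eq]
    · refine tsum_congr fun n ↦ ?_
      rw [lipschitzKernel_of_pos (by positivity)]
      push_cast
      congr 2
      ring
    · intro n hn
      have hpos : 0 < n := by
        by_contra! h
        exact hn (lipschitzKernel_of_nonpos hs (by exact_mod_cast h))
      exact ⟨(n - 1).toNat, by simp only; omega⟩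
  have hright : ∑' n : ℤ, (z - n) ^ (-s) = ∑' n : ℤ, (z + n) ^ (-s) := by
    rw [← (Equiv.neg ℤ).tsum_eq]
    simp
  simp only [zero_add, QuotientAddGroup.mk_zero, fourier_eval_zero, mul_one] at hpoisson
  simp_rw [fourier_lipschitzKernel hz hs] at hpoisson
  rw [← hleft, hpoisson, tsum_mul_left, ← hright]
  simp

/-- The bilateral zeta function `ξ₁(s, z | e^{πi})` for `z` in the upper half-plane
equals `e^{-πis/2}(2π)^s/Γ(s) Σ_{n≥1} n^{s-1} e^{2πinz}` for `Re(s) > 1`.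
Here `e^{πi}` is `-1`, whose principal argument is `π`, and complex powers use the
principal branch. -/
theorem bilateralZeta_one_fourier (z : ℂ) (hz : 0 < z.im) (s : ℂ) (hs : 1 < s.re) :
    (∑' n : ℕ, (z + (-1) + (n : ℂ) * (-1)) ^ (-s)) + (∑' n : ℕ, (z + (n : ℂ)) ^ (-s))
      = Complex.exp (-(π * I * s) / 2) * (2 * π : ℂ) ^ s / Complex.Gamma s *
          ∑' n : ℕ, ((n : ℂ) + 1) ^ (s - 1) * Complex.exp (2 * π * I * ((n : ℂ) + 1) * z) := by
  have hsum := summable_int_add_cpow_neg z hs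
  have hsplit : (∑' n : ℕ, (z + (-1) + (n : ℂ) * (-1)) ^ (-s)) + (∑' n : ℕ, (z + (n : ℂ)) ^ (-s))
      = ∑' n : ℤ, (z + n) ^ (-s) := by
    have hneg : Function.Injective fun n : ℕ ↦ -((n : ℤ) + 1) := fun a b h ↦ by simpa using h
    rw [tsum_of_nat_of_neg_add_one (f := fun n : ℤ ↦ (z + n) ^ (-s))
      (hsum.comp_injective Nat.cast_injective) (hsum.comp_injective hneg), add_comm]
    simp only [Int.cast_natCast]
    congr 1
    refine tsum_congr fun n ↦ ?_
    push_cast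
    ring_nf
  have hexp : Complex.exp (-(π * I * s) / 2) * Complex.exp (π * I * s / 2) = 1 := by
    rw [← Complex.exp_add, neg_div, neg_add_cancel, Complex.exp_zero]
  have hpow : (2 * π : ℂ) ^ s * (2 * π : ℂ) ^ (-s) = 1 := by
    have h2pi : (2 * π : ℂ) ≠ 0 := by simp [Real.pi_ne_zero]
    rw [← Complex.cpow_add _ _ h2pi, add_neg_cancel, Complex.cpow_zero]
  have hGamma : Complex.Gamma s ≠ 0 := Complex.Gamma_ne_zero_of_re_pos (by linarith)
  rw [hsplit, tsum_cpow_mul_exp_eq_tsum_int hz hs, div_mul_eq_mul_div, eq_div_iff hGamma]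
  linear_combination (-(∑' n : ℤ, (z + n) ^ (-s)) * Complex.Gamma s)
    * (hexp * ((2 * π : ℂ) ^ s * (2 * π : ℂ) ^ (-s)) + hpow)
end

section
/- For z, ω₁, ..., ω_r all in the upper half-plane and Re(s) > r+1, the bilateral multiple zeta function ξ_{r+1}(s, z | e^{πi}; ω₁,...,ω_r) equals e^{-πis/2}(2π)^s/Γ(s) · Σ_{n≥1} n^{s-1} e^{2πinz} / ∏_{j=1}^r (1 − e^{2πinω_j}). -/
open Complex Real

/-- The Barnes multiple zeta series (principal-branch powers). -/
noncomputable def barnesZeta (r : ℕ) (s z : ℂ) (ω : Fin r → ℂ) : ℂ :=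
  ∑' m : Fin r → ℕ, (z + ∑ j, (m j : ℂ) * ω j) ^ (-s)

/-- The bilateral multiple zeta series `ξ_{r+1}(s, z | e^{πi}; ω)`, where
`e^{πi} = -1` (with principal argument `π`) and `-e^{πi} = 1`:
`ξ_{r+1}(s,z|e^{πi};ω) = ζ_{r+1}(s, z + e^{πi} | e^{πi}, ω) + ζ_{r+1}(s, z | 1, ω)`. -/
noncomputable def xiSeries (r : ℕ) (s z : ℂ) (ω : Fin r → ℂ) : ℂ :=
  barnesZeta (r + 1) s (z + (-1)) (Fin.cons (-1) ω)
    + barnesZeta (r + 1) s z (Fin.cons 1 ω)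


open Filter Topology MeasureTheory FourierTransform

/-- Distributivity of finite products over absolutely convergent series. -/
theorem summable_norm_and_tsum_prod_pi {R : Type*} [NormedCommRing R] [NormOneClass R]
    [CompleteSpace R] {d : ℕ} (f : Fin d → ℕ → R) (hf : ∀ j, Summable fun n ↦ ‖f j n‖) :
    (Summable fun m : Fin d → ℕ ↦ ‖∏ j, f j (m j)‖) ∧
      ∑' m : Fin d → ℕ, ∏ j, f j (m j) = ∏ j, ∑' n, f j n := by
  induction d with
  | zero => exact ⟨Summable.of_finite, by simp⟩
  | succ d ih =>
    obtain ⟨hs, ht⟩ := ih (fun j ↦ f j.succ) fun j ↦ hf j.succ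
    have key (p : ℕ × (Fin d → ℕ)) :
        ∏ j, f j (Fin.consEquiv (fun _ ↦ ℕ) p j) = f 0 p.1 * ∏ j, f j.succ (p.2 j) := by
      simp [Fin.prod_univ_succ, Fin.consEquiv]
    constructor
    · rw [← (Fin.consEquiv fun _ ↦ ℕ).summable_iff]
      simpa only [Function.comp_def, key] using (hf 0).mul_norm hs
    · rw [← (Fin.consEquiv fun _ ↦ ℕ).tsum_eq, Fin.prod_univ_succ, ← ht,
        tsum_mul_tsum_of_summable_norm (hf 0) hs]
      simp only [key]

theorem summable_one_add_sum_rpow (d : ℕ) {σ : ℝ} (hσ : d < σ) :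
    Summable fun m : Fin d → ℕ ↦ (1 + ∑ j, (m j : ℝ)) ^ (-σ) := by
  rcases Nat.eq_zero_or_pos d with rfl | hd
  · exact Summable.of_finite
  have hd' : (0 : ℝ) < d := by exact_mod_cast hd
  have h1 : Summable fun n : ℕ ↦ ‖((n : ℝ) + 1) ^ (-(σ / d))‖ := by
    have := (summable_nat_add_iff 1).2
      (Real.summable_nat_rpow.2 (neg_lt_neg ((one_lt_div hd').2 hσ)))
    exact (by simpa using this : Summable fun n : ℕ ↦ ((n : ℝ) + 1) ^ (-(σ / d))).norm
  refine Summable.of_nonneg_of_le (fun m ↦ by positivity) (fun m ↦ ?_)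
    (summable_norm_and_tsum_prod_pi (fun _ : Fin d ↦ fun n : ℕ ↦ ((n : ℝ) + 1) ^ (-(σ / d)))
      fun _ ↦ h1).1
  have hS : 0 < 1 + ∑ j, (m j : ℝ) := by positivity
  calc (1 + ∑ j, (m j : ℝ)) ^ (-σ)
      = ∏ _j : Fin d, (1 + ∑ j, (m j : ℝ)) ^ (-(σ / d)) := by
        rw [Finset.prod_const, Finset.card_univ, Fintype.card_fin, ← Real.rpow_natCast,
          ← Real.rpow_mul hS.le]
        congr 1
        field_simp
    _ ≤ ∏ j, ((m j : ℝ) + 1) ^ (-(σ / d)) := by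
        refine Finset.prod_le_prod (fun _ _ ↦ by positivity) fun j _ ↦ ?_
        refine Real.rpow_le_rpow_of_nonpos (by positivity) ?_
          (neg_nonpos.2 (div_nonneg (hd'.trans hσ).le hd'.le))
        have := Finset.single_le_sum (f := fun j ↦ (m j : ℝ)) (fun _ _ ↦ by positivity)
          (Finset.mem_univ j)
        linarith
    _ ≤ _ := Real.le_norm_self _

/-- Absolute convergence of the Barnes series when `z` and the parameters lie in a common open
half-plane. -/
theorem summable_barnesZeta {d : ℕ} {s z u : ℂ} {ω : Fin d → ℂ} (hz : 0 < (z * u).re)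
    (hω : ∀ j, 0 < (ω j * u).re) (hs : d < s.re) :
    Summable fun m : Fin d → ℕ ↦ (z + ∑ j, (m j : ℂ) * ω j) ^ (-s) := by
  obtain ⟨c, hc, hcz, hcω⟩ : ∃ c : ℝ, 0 < c ∧ c ≤ (z * u).re ∧ ∀ j, c ≤ (ω j * u).re := by
    have h0 (a : ℝ) (ha : 0 < a) : ∀ᶠ c in 𝓝[>] (0 : ℝ), c ≤ a :=
      mem_of_superset (Ioc_mem_nhdsGT ha) fun _ h ↦ h.2
    obtain ⟨c, h⟩ := ((eventually_mem_nhdsWithin (a := (0 : ℝ)) (s := Set.Ioi 0)).and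
      ((h0 _ hz).and (eventually_all.2 fun j ↦ h0 _ (hω j)))).exists
    exact ⟨c, h.1, h.2⟩
  have hu : 0 < ‖u‖ := norm_pos_iff.2 fun h ↦ by simp [h] at hz
  refine Summable.of_norm_bounded (((summable_one_add_sum_rpow d hs).mul_left
    ((c / ‖u‖) ^ (-s.re))).mul_right (Real.exp (π * |s.im|))) fun m ↦ ?_
  set w := z + ∑ j, (m j : ℂ) * ω j with hw
  have hlow : c / ‖u‖ * (1 + ∑ j, (m j : ℝ)) ≤ ‖w‖ := by
    rw [div_mul_eq_mul_div, div_le_iff₀ hu, ← norm_mul]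
    refine le_trans ?_ (Complex.re_le_norm _)
    have : (w * u).re = (z * u).re + ∑ j, (m j : ℝ) * (ω j * u).re := by
      rw [hw, add_mul, Finset.sum_mul, Complex.add_re, Complex.re_sum]
      simp only [mul_assoc, ← Complex.ofReal_natCast, Complex.re_ofReal_mul]
    rw [this, mul_add, mul_one, Finset.mul_sum]
    refine add_le_add hcz (Finset.sum_le_sum fun j _ ↦ ?_)
    rw [mul_comm]
    exact mul_le_mul_of_nonneg_left (hcω j) (by positivity)
  have hσ : 0 < s.re := (Nat.cast_nonneg d).trans_lt hs
  refine (Complex.norm_cpow_le _ _).trans ?_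
  rw [div_eq_mul_inv, ← Real.exp_neg, ← Real.mul_rpow (by positivity) (by positivity)]
  refine mul_le_mul (Real.rpow_le_rpow_of_nonpos (by positivity) hlow (by simpa using hσ.le))
    (Real.exp_le_exp.2 ?_) (by positivity) (by positivity)
  rw [Complex.neg_im, mul_neg, neg_neg]
  refine (le_abs_self _).trans ?_
  rw [abs_mul]
  exact mul_le_mul_of_nonneg_right (Complex.abs_arg_le_pi w) (abs_nonneg _)

/-- Laplace transform of `t ↦ t ^ (a - 1)`, for a complex parameter. -/
theorem integral_cpow_mul_exp_neg_mul_Ioi_of_re_pos {a p : ℂ} (ha : 0 < a.re) (hp : 0 < p.re) :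
    ∫ t : ℝ in Set.Ioi 0, (t : ℂ) ^ (a - 1) * Complex.exp (-(p * t)) =
      p ^ (-a) * Complex.Gamma a := by
  let U : Set ℂ := {p | 0 < p.re}
  have hU : IsOpen U := isOpen_lt continuous_const Complex.continuous_re
  have hcont (b p : ℂ) : ContinuousOn
      (fun t : ℝ ↦ (t : ℂ) ^ b * Complex.exp (-(p * t))) (Set.Ioi 0) := by
    refine ContinuousOn.mul (fun t ht ↦ ?_) (by fun_prop)
    exact (Complex.continuousAt_ofReal_cpow_const t b (.inr (ne_of_gt ht))).continuousWithinAt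
  have hint {b : ℝ} (hb : -1 < b) {q : ℝ} (hq : 0 < q) :
      IntegrableOn (fun t : ℝ ↦ t ^ b * Real.exp (-q * t)) (Set.Ioi 0) := by
    simpa using integrableOn_rpow_mul_exp_neg_mul_rpow hb zero_lt_one hq
  have hnorm (b p : ℂ) {t : ℝ} (ht : 0 < t) :
      ‖(t : ℂ) ^ b * Complex.exp (-(p * t))‖ = t ^ b.re * Real.exp (-p.re * t) := by
    rw [norm_mul, Complex.norm_cpow_eq_rpow_re_of_pos ht, Complex.norm_exp]
    simp
  have hF : DifferentiableOn ℂ (fun p : ℂ ↦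
      ∫ t : ℝ in Set.Ioi 0, (t : ℂ) ^ (a - 1) * Complex.exp (-(p * t))) U := by
    intro p hp
    have hp : 0 < p.re := hp
    refine (hasDerivAt_integral_of_dominated_loc_of_deriv_le
      (F' := fun q (t : ℝ) ↦ -((t : ℂ) ^ a * Complex.exp (-(q * t))))
      (bound := fun t ↦ t ^ a.re * Real.exp (-(p.re / 2) * t))
      (s := {q : ℂ | p.re / 2 < q.re})
      ((isOpen_lt continuous_const Complex.continuous_re).mem_nhds (half_lt_self hp))
      (.of_forall fun q ↦ (hcont _ _).aestronglyMeasurable measurableSet_Ioi) ?_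
      ((hcont _ _).aestronglyMeasurable measurableSet_Ioi).neg ?_ (hint (by linarith)
      (half_pos hp)) ?_).2.differentiableAt.differentiableWithinAt
    · refine (hint (b := (a - 1).re) (by simpa using ha) hp).mono'
        ((hcont _ _).aestronglyMeasurable measurableSet_Ioi) ?_
      filter_upwards [ae_restrict_mem measurableSet_Ioi] with t ht
      exact (hnorm _ _ ht).le
    · filter_upwards [ae_restrict_mem measurableSet_Ioi] with t ht q hq
      rw [norm_neg, hnorm _ _ ht]
      have ht : 0 < t := ht
      have hq : p.re / 2 < q.re := hq
      gcongr
    · filter_upwards [ae_restrict_mem measurableSet_Ioi] with t ht q hq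
      have ht' : (t : ℂ) ≠ 0 := Complex.ofReal_ne_zero.2 (ne_of_gt ht)
      have := (((hasDerivAt_id q).mul_const (t : ℂ)).neg.cexp).const_mul ((t : ℂ) ^ (a - 1))
      convert! this using 1
      rw [Complex.cpow_sub _ _ ht', Complex.cpow_one]
      simp
      field_simp
  have hG : DifferentiableOn ℂ (fun p : ℂ ↦ p ^ (-a) * Complex.Gamma a) U := fun p hp ↦
    (DifferentiableAt.mul_const (differentiableAt_id.cpow_const (.inl hp)) _).differentiableWithinAt
  refine (hF.analyticOnNhd hU).eqOn_of_preconnected_of_frequently_eq (hG.analyticOnNhd hU)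
    (convex_halfSpace_re_gt 0).isPreconnected (z₀ := 1) (by simp [U]) ?_ hp
  have ht : Tendsto (fun x : ℝ ↦ (x : ℂ)) (𝓝[>] 1) (𝓝[≠] 1) := by
    refine tendsto_nhdsWithin_iff.2 ⟨?_, ?_⟩
    · exact (Complex.continuous_ofReal.tendsto' 1 1 (by simp)).mono_left nhdsWithin_le_nhds
    · filter_upwards [self_mem_nhdsWithin] with x hx
      have hx : 1 < x := hx
      simpa using hx.ne'
  refine ht.frequently (Eventually.frequently ?_)
  filter_upwards [self_mem_nhdsWithin] with x hx
  have hx : 0 < x := zero_lt_one.trans hx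
  rw [Complex.integral_cpow_mul_exp_neg_mul_Ioi ha hx, one_div, Complex.inv_cpow,
    Complex.cpow_neg]
  rw [Complex.arg_ofReal_of_nonneg hx.le]
  exact pi_pos.ne

theorem eventually_re_mul_pos {w : ℂ} (hw : 0 < w.im) (c : ℝ) :
    ∀ᶠ ε : ℝ in 𝓝[>] 0, 0 < (w * ((ε * c : ℝ) - I)).re := by
  have h : Tendsto (fun ε : ℝ ↦ (w * ((ε * c : ℝ) - I)).re) (𝓝 0) (𝓝 w.im) := by
    refine Continuous.tendsto' ?_ _ _ (by simp)
    fun_prop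
  exact (h.mono_left nhdsWithin_le_nhds).eventually_const_lt hw

theorem summable_barnesZeta_cons {r : ℕ} {s z : ℂ} {ω : Fin r → ℂ} (hz : 0 < z.im)
    (hω : ∀ j, 0 < (ω j).im) (hs : (r : ℝ) + 1 < s.re) {c : ℝ} (hc : c ≠ 0) :
    Summable fun p : (Fin r → ℕ) × ℕ ↦
      (z + ((p.2 : ℂ) * c + ∑ j, (p.1 j : ℂ) * ω j)) ^ (-s) := by
  obtain ⟨ε, hε, hεz, hεω⟩ := ((eventually_mem_nhdsWithin (a := (0 : ℝ)) (s := Set.Ioi 0)).and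
    ((eventually_re_mul_pos hz c).and
      (eventually_all.2 fun j ↦ eventually_re_mul_pos (hω j) c))).exists
  have hε : 0 < ε := hε
  have := summable_barnesZeta (ω := Fin.cons (c : ℂ) ω) (s := s) hεz (fun j ↦ by
    refine Fin.cases ?_ (fun j ↦ ?_) j
    · have : 0 < ε * (c * c) := mul_pos hε (mul_self_pos.2 hc)
      simp
      linarith
    · simpa using hεω j) (by simpa using hs)
  rw [← ((Equiv.prodComm _ _).trans (Fin.consEquiv fun _ ↦ ℕ)).summable_iff] at this
  simpa [Function.comp_def, Fin.sum_univ_succ, Fin.consEquiv] using this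

theorem barnesZeta_cons (r : ℕ) (s z c : ℂ) (ω : Fin r → ℂ) :
    barnesZeta (r + 1) s z (Fin.cons c ω) =
      ∑' p : (Fin r → ℕ) × ℕ, (z + ((p.2 : ℂ) * c + ∑ j, (p.1 j : ℂ) * ω j)) ^ (-s) := by
  rw [barnesZeta, ← ((Equiv.prodComm _ _).trans (Fin.consEquiv fun _ ↦ ℕ)).tsum_eq]
  simp [Fin.sum_univ_succ, Fin.consEquiv]

/-- The sum over `ℤ` splits into the two halves occurring in the bilateral zeta series. -/
theorem hasSum_add_intCast_cpow {s z : ℂ} (hz : 0 < z.im) (hs : 1 < s.re) :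
    HasSum (fun k : ℤ ↦ (z + k) ^ (-s))
      (∑' k : ℕ, (z + k) ^ (-s) + ∑' k : ℕ, (z + (-1) - k) ^ (-s)) := by
  have h {w : ℂ} (hw : 0 < w.im) {c : ℝ} (hc : c ≠ 0) :
      Summable fun k : ℕ ↦ (w + (k : ℂ) * c) ^ (-s) := by
    have := (summable_barnesZeta_cons (r := 0) (ω := Fin.elim0) hw (fun j ↦ j.elim0)
      (by simpa using hs) hc).prod_factor Fin.elim0
    simpa using this
  have h₁ : Summable fun k : ℕ ↦ (z + k) ^ (-s) := by simpa using h hz one_ne_zero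
  have h₂ : Summable fun k : ℕ ↦ (z + (-1) - k) ^ (-s) := by
    simpa [sub_eq_add_neg] using
      h (w := z + (-1)) (by simpa using hz) (neg_ne_zero.2 one_ne_zero)
  refine HasSum.of_nat_of_neg_add_one (by simpa using h₁.hasSum) ?_
  convert! h₂.hasSum using 3 with k
  push_cast
  ring

theorem im_add_sum_pos {r : ℕ} {z : ℂ} {ω : Fin r → ℂ} (hz : 0 < z.im)
    (hω : ∀ j, 0 < (ω j).im) (m : Fin r → ℕ) : 0 < (z + ∑ j, (m j : ℂ) * ω j).im := by
  rw [Complex.add_im, Complex.im_sum]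
  refine add_pos_of_pos_of_nonneg hz (Finset.sum_nonneg fun j _ ↦ ?_)
  rw [← Complex.ofReal_natCast, Complex.im_ofReal_mul]
  exact mul_nonneg (by positivity) (hω j).le

/-- The bilateral zeta series as a sum over the lattice points with an integral inner sum. -/
theorem xiSeries_eq_tsum_tsum_int {r : ℕ} {s z : ℂ} {ω : Fin r → ℂ} (hz : 0 < z.im)
    (hω : ∀ j, 0 < (ω j).im) (hs : (r : ℝ) + 1 < s.re) :
    xiSeries r s z ω =
      ∑' m : Fin r → ℕ, ∑' k : ℤ, (z + ∑ j, (m j : ℂ) * ω j + k) ^ (-s) := by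
  have h₁ := summable_barnesZeta_cons hz hω hs one_ne_zero
  have h₂ := summable_barnesZeta_cons (z := z + (-1)) (by simpa using hz) hω hs
    (neg_ne_zero.2 one_ne_zero)
  simp only [Complex.ofReal_one, Complex.ofReal_neg] at h₁ h₂
  rw [xiSeries, barnesZeta_cons, barnesZeta_cons, add_comm, h₁.tsum_prod, h₂.tsum_prod,
    ← h₁.prod.tsum_add h₂.prod]
  refine tsum_congr fun m ↦ ?_
  have hm := im_add_sum_pos hz hω m
  have hs1 : 1 < s.re := by linarith [Nat.cast_nonneg (α := ℝ) r]
  rw [(hasSum_add_intCast_cpow hm hs1).tsum_eq]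
  congr 1 <;> refine tsum_congr fun k ↦ ?_ <;> ring_nf

theorem cpow_neg_eq_of_im_pos {w : ℂ} (hw : 0 < w.im) (s : ℂ) :
    w ^ (-s) = Complex.exp (-(π * I * s) / 2) * (2 * π : ℂ) ^ s * (-(2 * π * I * w)) ^ (-s) := by
  have hw0 : w ≠ 0 := fun h ↦ by simp [h] at hw
  have h2 : (0 : ℝ) < 2 * π := by positivity
  have h2' : (2 * π : ℂ) ≠ 0 := by exact_mod_cast h2.ne'
  have harg : (-I).arg + w.arg ∈ Set.Ioc (-π) π := by
    have h1 := Complex.arg_nonneg_iff.2 hw.le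
    have h3 := Complex.arg_le_pi w
    rw [Complex.arg_neg_I]
    constructor <;> linarith [pi_pos]
  have hlog : Complex.log (-(2 * π * I * w)) =
      Complex.log (2 * π) + (-(π / 2) * I + Complex.log w) := by
    have : -(2 * π * I * w) = ((2 * π : ℝ) : ℂ) * (-I * w) := by push_cast; ring
    rw [this, Complex.log_ofReal_mul h2 (mul_ne_zero (neg_ne_zero.2 I_ne_zero) hw0),
      Complex.log_mul (neg_ne_zero.2 I_ne_zero) hw0 harg, Complex.log_neg_I,
      Complex.ofReal_log h2.le]
    push_cast
    rfl
  rw [Complex.cpow_def_of_ne_zero hw0, Complex.cpow_def_of_ne_zero h2',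
    Complex.cpow_def_of_ne_zero (neg_ne_zero.2 (mul_ne_zero (mul_ne_zero h2' I_ne_zero) hw0)),
    hlog, ← Complex.exp_add, ← Complex.exp_add]
  congr 1
  ring

/-- The **Lipschitz summation formula** with complex exponent. -/
theorem tsum_add_intCast_cpow {s z : ℂ} (hz : 0 < z.im) (hs : 1 < s.re) :
    ∑' k : ℤ, (z + k) ^ (-s) =
      Complex.exp (-(π * I * s) / 2) * (2 * π : ℂ) ^ s / Complex.Gamma s *
        ∑' n : ℕ, ((n : ℂ) + 1) ^ (s - 1) * Complex.exp (2 * π * I * ((n : ℂ) + 1) * z) := by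
  have hs0 : 0 < s.re := zero_lt_one.trans hs
  have hs1 : 0 < (s - 1).re := by simpa using hs
  have hs1' : s - 1 ≠ 0 := fun h ↦ by simp [h] at hs1
  let f : ℝ → ℂ := fun x ↦ ((max x 0 : ℝ) : ℂ) ^ (s - 1) * Complex.exp (2 * π * I * x * z)
  have hf0 {x : ℝ} (hx : x ≤ 0) : f x = 0 := by simp [f, max_eq_right hx, hs1']
  have hfp {x : ℝ} (hx : 0 ≤ x) : f x = (x : ℂ) ^ (s - 1) * Complex.exp (2 * π * I * x * z) := by
    simp [f, max_eq_left hx]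
  have hc : Continuous f := by
    refine Continuous.mul ?_ (by fun_prop)
    exact (Complex.continuous_ofReal_cpow_const hs1).comp (continuous_id.max continuous_const)
  have hdecay : f =O[cocompact ℝ] fun x : ℝ ↦ |x| ^ (-2 : ℝ) := by
    rw [cocompact_eq_atBot_atTop, Asymptotics.isBigO_sup]
    constructor
    · refine Asymptotics.IsBigO.of_bound 0 ?_
      filter_upwards [eventually_le_atBot 0] with x hx
      simp [hf0 hx]
    · have hb : 0 < 2 * π * z.im := by positivity
      have ht := tendsto_rpow_mul_exp_neg_mul_atTop_nhds_zero ((s - 1).re + 2) _ hb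
      refine Asymptotics.IsBigO.of_bound 1 ?_
      filter_upwards [ht.eventually_le_const zero_lt_one, eventually_gt_atTop 0] with x hx hx0
      rw [hfp hx0.le, norm_mul, Complex.norm_cpow_eq_rpow_re_of_pos hx0, Complex.norm_exp,
        Real.norm_of_nonneg (by positivity), abs_of_pos hx0, Real.rpow_neg hx0.le, one_mul,
        ← one_div, le_div_iff₀ (by positivity)]
      refine le_trans (le_of_eq ?_) hx
      rw [Real.rpow_add hx0]
      have : (2 * π * I * x * z).re = -(2 * π * z.im) * x := by
        simp
        ring
      rw [this]
      ring
  have hfourier (k : ℤ) : 𝓕 f k = (-(2 * π * I * (z - k))) ^ (-s) * Complex.Gamma s := by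
    rw [← integral_cpow_mul_exp_neg_mul_Ioi_of_re_pos hs0 (by simp; positivity),
      Real.fourier_real_eq_integral_exp_smul,
      ← setIntegral_eq_integral_of_forall_compl_eq_zero (s := Set.Ioi 0)
        fun x hx ↦ by rw [hf0 (not_lt.1 hx), smul_zero]]
    refine setIntegral_congr_fun measurableSet_Ioi fun x hx ↦ ?_
    simp only [hfp (le_of_lt hx), smul_eq_mul]
    rw [mul_left_comm, ← Complex.exp_add]
    congr 2
    push_cast
    ring
  have hΓ : Complex.Gamma s ≠ 0 := Complex.Gamma_ne_zero_of_re_pos hs0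
  set C := Complex.exp (-(π * I * s) / 2) * (2 * π : ℂ) ^ s with hC
  have hC0 : C ≠ 0 := mul_ne_zero (Complex.exp_ne_zero _)
    (by simp [Complex.cpow_eq_zero_iff, pi_ne_zero])
  have hfourier' (k : ℤ) : 𝓕 f k = Complex.Gamma s / C * (z + (-k : ℤ)) ^ (-s) := by
    have hzk : 0 < (z - k).im := by simpa using hz
    rw [hfourier, Int.cast_neg, ← sub_eq_add_neg, cpow_neg_eq_of_im_pos hzk s, ← hC]
    field_simp
  have hsum := (hasSum_add_intCast_cpow hz hs).summable
  have hpoisson := Real.tsum_eq_tsum_fourier_of_rpow_decay_of_summable hc one_lt_two hdecay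
    (by
      simp only [hfourier']
      exact ((Equiv.neg ℤ).summable_iff.2 hsum).mul_left _) 0
  simp only [zero_add, hfourier', QuotientAddGroup.mk_zero, fourier_eval_zero, mul_one,
    tsum_mul_left] at hpoisson
  have hneg := (Equiv.neg ℤ).tsum_eq fun k : ℤ ↦ (z + k) ^ (-s)
  simp only [Equiv.neg_apply] at hneg
  rw [hneg] at hpoisson
  have hinj : Function.Injective fun n : ℕ ↦ ((n : ℤ) + 1) := fun a b h ↦ by simpa using h
  have hnat : ∑' k : ℤ, f k =
      ∑' n : ℕ, ((n : ℂ) + 1) ^ (s - 1) * Complex.exp (2 * π * I * ((n : ℂ) + 1) * z) := by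
    rw [← hinj.tsum_eq]
    · refine tsum_congr fun n ↦ ?_
      rw [hfp (by positivity)]
      push_cast
      rfl
    · intro k hk
      have hk0 : 0 < k := by
        by_contra! h
        exact hk (hf0 (by exact_mod_cast h))
      exact ⟨(k - 1).toNat, by simp; omega⟩
  rw [← hnat, hpoisson]
  field_simp

theorem norm_exp_two_pi_I_mul (n : ℕ) (w : ℂ) :
    ‖Complex.exp (2 * π * I * ((n : ℂ) + 1) * w)‖ = Real.exp (-(2 * π * w.im)) ^ (n + 1) := by
  rw [← Real.exp_nat_mul, Complex.norm_exp]
  congr 1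
  have : 2 * π * I * ((n : ℂ) + 1) * w = ((2 * π * (n + 1 : ℕ) : ℝ) : ℂ) * (I * w) := by
    push_cast
    ring
  rw [this, Complex.re_ofReal_mul, Complex.I_mul_re]
  ring

theorem exp_neg_two_pi_mul_lt_one {y : ℝ} (hy : 0 < y) : Real.exp (-(2 * π * y)) < 1 :=
  Real.exp_lt_one_iff.2 (neg_lt_zero.2 (by positivity))

theorem summable_norm_cpow_mul_exp {z : ℂ} (hz : 0 < z.im) (s : ℂ) :
    Summable fun n : ℕ ↦
      ‖((n : ℂ) + 1) ^ (s - 1) * Complex.exp (2 * π * I * ((n : ℂ) + 1) * z)‖ := by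
  obtain ⟨N, hN⟩ := exists_nat_ge (s - 1).re
  have h := (summable_nat_add_iff 1).2 (summable_pow_mul_geometric_of_norm_lt_one N
    (r := Real.exp (-(2 * π * z.im))) (by
      rw [Real.norm_of_nonneg (Real.exp_nonneg _)]
      exact exp_neg_two_pi_mul_lt_one hz))
  refine Summable.of_nonneg_of_le (fun _ ↦ norm_nonneg _) (fun n ↦ ?_) h
  rw [norm_mul, norm_exp_two_pi_I_mul]
  have : ((n : ℂ) + 1) = ((n + 1 : ℝ) : ℂ) := by push_cast; rfl
  rw [this, Complex.norm_cpow_eq_rpow_re_of_pos (by positivity)]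
  gcongr
  rw [← Real.rpow_natCast]
  push_cast
  exact Real.rpow_le_rpow_of_exponent_le (by linarith [Nat.cast_nonneg (α := ℝ) n]) hN

theorem exp_mul_add_sum {r : ℕ} (a z : ℂ) (ω : Fin r → ℂ) (m : Fin r → ℕ) :
    Complex.exp (a * (z + ∑ j, (m j : ℂ) * ω j)) =
      Complex.exp (a * z) * ∏ j, Complex.exp (a * ω j) ^ m j := by
  rw [mul_add, Complex.exp_add, Finset.mul_sum, Complex.exp_sum]
  congr 1
  refine Finset.prod_congr rfl fun j _ ↦ ?_
  rw [← Complex.exp_nat_mul]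
  congr 1
  ring

theorem tsum_prod_pow {r : ℕ} {q : Fin r → ℂ} (hq : ∀ j, ‖q j‖ < 1) :
    ∑' m : Fin r → ℕ, ∏ j, q j ^ m j = (∏ j, (1 - q j))⁻¹ := by
  rw [(summable_norm_and_tsum_prod_pi (fun j n ↦ q j ^ n)
    fun j ↦ by simpa using summable_geometric_of_lt_one (norm_nonneg _) (hq j)).2,
    ← Finset.prod_inv_distrib]
  exact Finset.prod_congr rfl fun j _ ↦ tsum_geometric_of_norm_lt_one (hq j)

/-- Fourier expansion of the bilateral multiple zeta function. -/
theorem xiSeries_fourier (r : ℕ) (z : ℂ) (ω : Fin r → ℂ)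
    (hz : 0 < z.im) (hω : ∀ j, 0 < (ω j).im)
    (s : ℂ) (hs : ((r : ℝ) + 1) < s.re) :
    xiSeries r s z ω
      = Complex.exp (-(π * I * s) / 2) * (2 * π : ℂ) ^ s / Complex.Gamma s *
          ∑' n : ℕ, ((n : ℂ) + 1) ^ (s - 1) * Complex.exp (2 * π * I * ((n : ℂ) + 1) * z)
            / ∏ j, (1 - Complex.exp (2 * π * I * ((n : ℂ) + 1) * ω j)) := by
  have hs1 : 1 < s.re := by linarith [Nat.cast_nonneg (α := ℝ) r]
  rw [xiSeries_eq_tsum_tsum_int hz hω hs]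
  simp only [tsum_add_intCast_cpow (im_add_sum_pos hz hω _) hs1, tsum_mul_left]
  congr 1
  simp only [exp_mul_add_sum, ← mul_assoc]
  have hq (n : ℕ) (j : Fin r) : ‖Complex.exp (2 * π * I * ((n : ℂ) + 1) * ω j)‖ < 1 := by
    rw [norm_exp_two_pi_I_mul]
    exact pow_lt_one₀ (Real.exp_nonneg _) (exp_neg_two_pi_mul_lt_one (hω j)) n.succ_ne_zero
  rw [Summable.tsum_comm]
  · refine tsum_congr fun n ↦ ?_
    rw [tsum_mul_left, tsum_prod_pow (hq n), div_eq_mul_inv]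
  · have hgeom := (summable_norm_and_tsum_prod_pi
      (fun j n ↦ Real.exp (-(2 * π * (ω j).im)) ^ n) fun j ↦ by
        simpa using summable_geometric_of_lt_one (Real.exp_nonneg _)
          (exp_neg_two_pi_mul_lt_one (hω j))).1
    refine Summable.of_norm_bounded ((summable_norm_cpow_mul_exp hz s).norm.mul_norm hgeom)
      fun p ↦ ?_
    simp only [Function.uncurry_def, norm_mul, norm_norm]
    refine mul_le_mul_of_nonneg_left ?_ (by positivity)
    rw [norm_prod, norm_prod]
    refine Finset.prod_le_prod (fun _ _ ↦ norm_nonneg _) fun j _ ↦ ?_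
    rw [norm_pow, norm_pow, norm_exp_two_pi_I_mul, Real.norm_of_nonneg (Real.exp_nonneg _)]
    exact pow_le_pow_left₀ (by positivity) (pow_le_of_le_one (Real.exp_nonneg _)
      (exp_neg_two_pi_mul_lt_one (hω j)).le (Nat.succ_ne_zero _)) _
end

section
/- For z, ω₁, ω₂ satisfying the one-side condition and any positive integer N, the limit as s → 2N of (1 − e^{πis}) ζ₂(s, z | ω₁, ω₂) equals −πi/(ω₁ω₂) if N = 1 and 0 if N ≥ 2. -/
open Complex Real

/-- The Barnes double zeta series `ζ₂(s, z | ω₁, ω₂)` (principal-branch powers),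
convergent for `Re(s) > 2`. -/
noncomputable def barnesZeta2 (s z ω₁ ω₂ : ℂ) : ℂ :=
  ∑' p : ℕ × ℕ, (z + (p.1 : ℂ) * ω₁ + (p.2 : ℂ) * ω₂) ^ (-s)

open Filter Topology Asymptotics Set MeasureTheory

theorem integrableOn_cpow_mul_exp_neg_mul_Ioi {s w : ℂ} (hs : 0 < s.re) (hw : 0 < w.re) :
    IntegrableOn (fun t : ℝ => (t : ℂ) ^ (s - 1) * cexp (-(w * t))) (Ioi 0) := by
  have h := integrableOn_rpow_mul_exp_neg_mul_rpow (s := s.re - 1) (p := 1) (b := w.re)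
    (by linarith) one_pos hw
  refine Integrable.mono' h ?_ ?_
  · refine ContinuousOn.aestronglyMeasurable (fun t ht => ?_) measurableSet_Ioi
    exact ((continuousAt_ofReal_cpow_const t (s - 1) (Or.inr ht.ne')).mul
      (by fun_prop)).continuousWithinAt
  · refine (ae_restrict_iff' measurableSet_Ioi).2 (ae_of_all _ fun t ht => ?_)
    rw [norm_mul, norm_cpow_eq_rpow_re_of_pos ht, Complex.norm_exp]
    simp

theorem integral_norm_cpow_mul_exp_neg_mul_Ioi {s w : ℂ} (hs : 0 < s.re) (hw : 0 < w.re) :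
    ∫ t : ℝ in Ioi 0, ‖(t : ℂ) ^ (s - 1) * cexp (-(w * t))‖ =
      (1 / w.re) ^ s.re * Real.Gamma s.re := by
  rw [← Real.integral_rpow_mul_exp_neg_mul_Ioi hs hw]
  refine setIntegral_congr_fun measurableSet_Ioi fun t ht => ?_
  rw [norm_mul, norm_cpow_eq_rpow_re_of_pos ht, Complex.norm_exp]
  simp

theorem differentiableAt_integral_cpow_mul_exp_neg_mul_Ioi {s w : ℂ} (hs : 0 < s.re)
    (hw : 0 < w.re) :
    DifferentiableAt ℂ (fun w : ℂ => ∫ t : ℝ in Ioi 0, (t : ℂ) ^ (s - 1) * cexp (-(w * t))) w := by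
  have hpos : 0 < w.re / 2 := by positivity
  have hball : ∀ v ∈ Metric.ball w (w.re / 2), w.re / 2 < v.re := fun v hv => by
    have h1 := (abs_re_le_norm (v - w)).trans_lt (mem_ball_iff_norm.1 hv)
    rw [sub_re] at h1
    linarith [(abs_lt.1 h1).1]
  have hmeas : ∀ v : ℂ, AEStronglyMeasurable
      (fun t : ℝ => (t : ℂ) ^ (s - 1) * cexp (-(v * t))) (volume.restrict (Ioi 0)) := fun v => by
    refine ContinuousOn.aestronglyMeasurable (fun t ht => ?_) measurableSet_Ioi
    exact ((continuousAt_ofReal_cpow_const t (s - 1) (Or.inr ht.ne')).mul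
      (by fun_prop)).continuousWithinAt
  refine (hasDerivAt_integral_of_dominated_loc_of_deriv_le (μ := volume.restrict (Ioi (0 : ℝ)))
    (F' := fun v (t : ℝ) => (t : ℂ) ^ (s - 1) * (cexp (-(v * t)) * -t))
    (bound := fun t : ℝ => t ^ s.re * rexp (-(w.re / 2) * t ^ (1 : ℝ)))
    (Metric.ball_mem_nhds w hpos) (Eventually.of_forall hmeas)
    (integrableOn_cpow_mul_exp_neg_mul_Ioi hs hw) ?_ ?_ ?_ ?_).2.differentiableAt
  · simp_rw [← mul_assoc]
    exact (hmeas w).mul (by fun_prop)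
  · refine (ae_restrict_iff' measurableSet_Ioi).2 (ae_of_all _ fun t ht v hv => ?_)
    have ht' : (0 : ℝ) < t := ht
    rw [norm_mul, norm_mul, norm_cpow_eq_rpow_re_of_pos ht, Complex.norm_exp, norm_neg,
      norm_real, Real.norm_of_nonneg ht'.le]
    have h1 : t ^ s.re = t ^ (s - 1).re * t := by
      rw [sub_re, one_re, ← Real.rpow_add_one ht'.ne']; simp
    have h2 : (-(v * t)).re ≤ -(w.re / 2) * t := by
      simp only [neg_re, mul_re, ofReal_re, ofReal_im, mul_zero, sub_zero]
      nlinarith [hball v hv]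
    rw [h1, Real.rpow_one, mul_assoc, mul_comm (rexp _)]
    gcongr
  · exact integrableOn_rpow_mul_exp_neg_mul_rpow (by linarith) one_pos hpos
  · refine ae_of_all _ fun t v _ => ?_
    refine HasDerivAt.const_mul _ (HasDerivAt.cexp ?_)
    simpa using! ((hasDerivAt_id v).mul_const (t : ℂ)).neg

/-- The Gamma integral with a complex rate. -/
theorem integral_cpow_mul_exp_neg_complex_mul_Ioi_s12 {s w : ℂ} (hs : 0 < s.re) (hw : 0 < w.re) :
    ∫ t : ℝ in Ioi 0, (t : ℂ) ^ (s - 1) * cexp (-(w * t)) = w ^ (-s) * Complex.Gamma s := by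
  have hopen : IsOpen {v : ℂ | 0 < v.re} := isOpen_lt continuous_const continuous_re
  have hf : AnalyticOnNhd ℂ
      (fun w : ℂ => ∫ t : ℝ in Ioi 0, (t : ℂ) ^ (s - 1) * cexp (-(w * t))) {v : ℂ | 0 < v.re} :=
    DifferentiableOn.analyticOnNhd (fun v hv =>
      (differentiableAt_integral_cpow_mul_exp_neg_mul_Ioi hs hv).differentiableWithinAt) hopen
  have hg : AnalyticOnNhd ℂ (fun w : ℂ => w ^ (-s) * Complex.Gamma s) {v : ℂ | 0 < v.re} :=
    DifferentiableOn.analyticOnNhd (fun v hv =>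
      ((differentiableAt_id.cpow_const (Or.inl hv)).mul_const _).differentiableWithinAt) hopen
  refine hf.eqOn_of_preconnected_of_frequently_eq hg (convex_halfSpace_re_gt 0).isPreconnected
    (z₀ := 1) (by simp) ?_ hw
  have htend : Tendsto (fun x : ℝ => (x : ℂ)) (𝓝[>] 1) (𝓝[≠] 1) := by
    refine tendsto_nhdsWithin_iff.2 ⟨?_, ?_⟩
    · simpa using (continuous_ofReal.tendsto (1 : ℝ)).mono_left nhdsWithin_le_nhds
    · filter_upwards [self_mem_nhdsWithin] with x hx
      simpa using (ne_of_gt hx : x ≠ 1)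
  refine htend.frequently (Eventually.frequently ?_)
  filter_upwards [self_mem_nhdsWithin] with x hx
  have hx : 0 < x := one_pos.trans hx
  rw [Complex.integral_cpow_mul_exp_neg_mul_Ioi hs hx, one_div, Complex.cpow_neg,
    Complex.inv_cpow]
  rw [arg_ofReal_of_nonneg hx.le]
  exact pi_pos.ne

theorem summable_one_div_add_add_two_rpow {σ : ℝ} (hσ : 2 < σ) :
    Summable fun p : ℕ × ℕ => 1 / ((p.1 : ℝ) + p.2 + 2) ^ σ := by
  have h1 : Summable fun n : ℕ => 1 / ((n : ℝ) + 1) ^ (σ / 2) := by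
    have := (summable_nat_add_iff 1).2 (Real.summable_one_div_nat_rpow (p := σ / 2).2 (by linarith))
    simpa using this
  refine Summable.of_nonneg_of_le (fun p => by positivity) (fun p => ?_)
    (h1.mul_of_nonneg h1 (fun n => by positivity) (fun n => by positivity))
  rw [one_div_mul_one_div, ← Real.mul_rpow (by positivity) (by positivity)]
  refine one_div_le_one_div_of_le (by positivity) ?_
  have h2 : ((p.1 : ℝ) + p.2 + 2) ^ σ = (((p.1 : ℝ) + p.2 + 2) ^ (2 : ℝ)) ^ (σ / 2) := by
    rw [← Real.rpow_mul (by positivity)]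
    congr 1
    ring
  rw [h2]
  refine Real.rpow_le_rpow (by positivity) ?_ (by linarith)
  rw [Real.rpow_two]
  have : (0 : ℝ) ≤ p.1 := by positivity
  have : (0 : ℝ) ≤ p.2 := by positivity
  nlinarith

/-- The Mellin transform of an exponential series over a planar family of frequencies is the
corresponding Dirichlet series; vanishing frequencies are omitted. -/
theorem hasSum_mellin_exp {w : ℕ × ℕ → ℂ} {c : ℝ} (hc : 0 < c)
    (hw : ∀ p, w p = 0 ∨ c * ((p.1 : ℝ) + p.2 + 2) ≤ (w p).re) {Φ : ℝ → ℂ}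
    (hΦ : ∀ t > 0, HasSum (fun p => if w p = 0 then 0 else cexp (-(w p * (t : ℝ)))) (Φ t))
    {s : ℂ} (hs : 2 < s.re) :
    HasSum (fun p => w p ^ (-s) * Complex.Gamma s) (mellin Φ s) := by
  have hs0 : 0 < s.re := by linarith
  have hpos : ∀ p, w p ≠ 0 → 0 < (w p).re := fun p hp =>
    lt_of_lt_of_le (by positivity) ((hw p).resolve_left hp)
  simp_rw [mellin, smul_eq_mul, ← setIntegral_congr_fun measurableSet_Ioi
    (fun t ht => congr_arg _ (hΦ t ht).tsum_eq), ← tsum_mul_left]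
  convert! hasSum_integral_of_summable_integral_norm (μ := volume.restrict (Ioi (0 : ℝ)))
    (F := fun p (t : ℝ) => (t : ℂ) ^ (s - 1) * if w p = 0 then 0 else cexp (-(w p * t)))
    (fun p => ?_) ?_ using 2 with p
  · by_cases hp : w p = 0
    · have : -s ≠ 0 := neg_ne_zero.2 fun h => by simp [h] at hs0
      simp [hp, zero_cpow this]
    · simp only [hp, if_false]
      rw [integral_cpow_mul_exp_neg_complex_mul_Ioi_s12 hs0 (hpos p hp)]
  · by_cases hp : w p = 0
    · simp [hp]
    · simp only [hp, if_false]
      exact integrableOn_cpow_mul_exp_neg_mul_Ioi hs0 (hpos p hp)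
  · refine Summable.of_nonneg_of_le (fun p => integral_nonneg fun t => norm_nonneg _) (fun p => ?_)
      ((summable_one_div_add_add_two_rpow hs).mul_left ((1 / c) ^ s.re * Real.Gamma s.re))
    have hG := Real.Gamma_pos_of_pos hs0
    by_cases hp : w p = 0
    · simp only [hp, if_true, mul_zero, norm_zero, integral_zero]
      positivity
    · simp only [hp, if_false]
      rw [integral_norm_cpow_mul_exp_neg_mul_Ioi hs0 (hpos p hp), mul_right_comm]
      refine mul_le_mul_of_nonneg_right ?_ hG.le
      rw [← Real.one_rpow s.re, ← Real.div_rpow zero_le_one (by positivity),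
        ← Real.mul_rpow (by positivity) (by positivity), Real.one_rpow, one_div_mul_one_div]
      have := hpos p hp
      exact Real.rpow_le_rpow (by positivity)
        (one_div_le_one_div_of_le (by positivity) ((hw p).resolve_left hp)) hs0.le

theorem norm_exp_neg_mul_lt_one {w : ℂ} (hw : 0 < w.re) {t : ℝ} (ht : 0 < t) :
    ‖cexp (-(w * t))‖ < 1 := by
  rw [Complex.norm_exp, Real.exp_lt_one_iff]
  simpa using mul_pos hw ht

theorem one_sub_exp_neg_mul_ne_zero {w : ℂ} (hw : 0 < w.re) {t : ℝ} (ht : 0 < t) :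
    1 - cexp (-(w * t)) ≠ 0 := fun h => by
  have := norm_exp_neg_mul_lt_one hw ht
  rw [← sub_eq_zero.1 h] at this
  simp at this

theorem exp_neg_mul_isBigO {w : ℂ} {a : ℝ} (h : a ≤ w.re) :
    (fun t : ℝ => cexp (-(w * t))) =O[atTop] fun t => rexp (-a * t) := by
  refine IsBigO.of_bound 1 ?_
  filter_upwards [eventually_ge_atTop 0] with t ht
  rw [Complex.norm_exp, Real.norm_of_nonneg (Real.exp_pos _).le, one_mul, Real.exp_le_exp]
  simp only [neg_re, mul_re, ofReal_re, ofReal_im, mul_zero, sub_zero]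
  nlinarith

/-- The generating function `e^{-zt} / ((1 - e^{-ω₁t})(1 - e^{-ω₂t}))` whose Mellin transform is
`Γ(s) ζ₂(s, z | ω₁, ω₂)`, corrected by its constant term when `z = 0`. -/
noncomputable def barnesKernel (z ω₁ ω₂ : ℂ) (t : ℝ) : ℂ :=
  cexp (-(z * t)) / ((1 - cexp (-(ω₁ * t))) * (1 - cexp (-(ω₂ * t)))) - if z = 0 then 1 else 0

theorem hasSum_barnesKernel {z ω₁ ω₂ : ℂ} (h₁ : 0 < ω₁.re) (h₂ : 0 < ω₂.re)
    (hz0 : z = 0 ∨ 0 < z.re) {t : ℝ} (ht : 0 < t) :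
    HasSum (fun p : ℕ × ℕ => if z + (p.1 : ℂ) * ω₁ + (p.2 : ℂ) * ω₂ = 0 then 0
      else cexp (-((z + (p.1 : ℂ) * ω₁ + (p.2 : ℂ) * ω₂) * t))) (barnesKernel z ω₁ ω₂ t) := by
  have hz : 0 ≤ z.re := hz0.elim (fun h => by simp [h]) le_of_lt
  have hiff : ∀ p : ℕ × ℕ, z + (p.1 : ℂ) * ω₁ + (p.2 : ℂ) * ω₂ = 0 ↔ z = 0 ∧ p = (0, 0) := by
    intro p
    refine ⟨fun h => ?_, fun h => by simp [h.1, h.2]⟩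
    have hre := congr_arg Complex.re h
    simp only [add_re, mul_re, natCast_re, natCast_im, zero_mul, sub_zero, zero_re] at hre
    have hp1 := mul_nonneg (Nat.cast_nonneg (α := ℝ) p.1) h₁.le
    have hp2 := mul_nonneg (Nat.cast_nonneg (α := ℝ) p.2) h₂.le
    refine ⟨hz0.resolve_right fun h => by linarith, Prod.ext ?_ ?_⟩
    · have : (p.1 : ℝ) * ω₁.re = 0 := by linarith
      simpa [h₁.ne'] using this
    · have : (p.2 : ℝ) * ω₂.re = 0 := by linarith
      simpa [h₂.ne'] using this
  have g₁ := hasSum_geometric_of_norm_lt_one (norm_exp_neg_mul_lt_one h₁ ht)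
  have g₂ := hasSum_geometric_of_norm_lt_one (norm_exp_neg_mul_lt_one h₂ ht)
  have hsum : HasSum (fun p : ℕ × ℕ => cexp (-(z * t)) *
      (cexp (-(ω₁ * t)) ^ p.1 * cexp (-(ω₂ * t)) ^ p.2))
      (cexp (-(z * t)) * ((1 - cexp (-(ω₁ * t)))⁻¹ * (1 - cexp (-(ω₂ * t)))⁻¹)) := by
    refine (g₁.mul g₂ (summable_mul_of_summable_norm ?_ ?_)).mul_left _
    · simpa using summable_geometric_of_lt_one (norm_nonneg _) (norm_exp_neg_mul_lt_one h₁ ht)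
    · simpa using summable_geometric_of_lt_one (norm_nonneg _) (norm_exp_neg_mul_lt_one h₂ ht)
  convert! hsum.sub (hasSum_ite_eq ((0, 0) : ℕ × ℕ) (if z = 0 then (1 : ℂ) else 0)) using 2 with p
  · have hexp : cexp (-((z + (p.1 : ℂ) * ω₁ + (p.2 : ℂ) * ω₂) * t)) = cexp (-(z * t)) *
        (cexp (-(ω₁ * t)) ^ p.1 * cexp (-(ω₂ * t)) ^ p.2) := by
      rw [← Complex.exp_nat_mul, ← Complex.exp_nat_mul, ← Complex.exp_add, ← Complex.exp_add]
      congr 1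
      ring
    by_cases hzz : z = 0
    · by_cases hp : p = (0, 0)
      · simp [hzz, hp]
      · rw [if_neg (fun h => hp ((hiff p).1 h).2), if_neg hp, sub_zero, hexp]
    · rw [if_neg (fun h => hzz ((hiff p).1 h).1), if_neg hzz, ite_self, sub_zero, hexp]
  · rw [barnesKernel, div_eq_mul_inv, mul_inv]

/-- The Barnes kernel minus `e^{-t} / (ω₁ω₂t²)`, which removes its double pole at `t = 0`. -/
noncomputable def barnesRemainder (z ω₁ ω₂ : ℂ) (t : ℝ) : ℂ :=
  barnesKernel z ω₁ ω₂ t - (ω₁ * ω₂)⁻¹ * ((t : ℂ) ^ (-2 : ℂ) * cexp (-(1 * t)))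

theorem continuousOn_barnesRemainder {z ω₁ ω₂ : ℂ} (h₁ : 0 < ω₁.re) (h₂ : 0 < ω₂.re) :
    ContinuousOn (barnesRemainder z ω₁ ω₂) (Ioi 0) := fun t ht => by
  have hne := mul_ne_zero (one_sub_exp_neg_mul_ne_zero h₁ ht) (one_sub_exp_neg_mul_ne_zero h₂ ht)
  have hc := continuousAt_ofReal_cpow_const t (-2) (Or.inr (ne_of_gt ht))
  have he : ∀ w : ℂ, ContinuousAt (fun t : ℝ => cexp (-(w * t))) t := fun w => by fun_prop
  have hden := (continuousAt_const (y := (1 : ℂ))).sub (he ω₁) |>.mul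
    ((continuousAt_const (y := (1 : ℂ))).sub (he ω₂))
  exact ((((he z).div hden hne).sub continuousAt_const).sub
    (continuousAt_const.mul (hc.mul (he 1)))).continuousWithinAt

theorem barnesRemainder_isBigO_atTop {z ω₁ ω₂ : ℂ} {a : ℝ} (ha : 0 < a) (ha1 : a ≤ 1)
    (h₁ : a ≤ ω₁.re) (h₂ : a ≤ ω₂.re) (hz : z = 0 ∨ a ≤ z.re) :
    barnesRemainder z ω₁ ω₂ =O[atTop] fun t => rexp (-a * t) := by
  have htend : ∀ {w : ℂ}, a ≤ w.re → Tendsto (fun t : ℝ => cexp (-(w * t))) atTop (𝓝 0) :=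
    fun hw => (exp_neg_mul_isBigO hw).trans_tendsto <| Real.tendsto_exp_atBot.comp <|
      tendsto_id.const_mul_atTop_of_neg (by linarith)
  have hden : (fun t : ℝ => ((1 - cexp (-(ω₁ * t))) * (1 - cexp (-(ω₂ * t))))⁻¹)
      =O[atTop] fun _ => (1 : ℝ) := by
    have h := (((htend h₁).const_sub 1).mul ((htend h₂).const_sub 1)).inv₀ (by simp)
    exact h.isBigO_one ℝ
  have hnum : (fun t : ℝ => cexp (-(z * t)) - (if z = 0 then 1 else 0) *
      ((1 - cexp (-(ω₁ * t))) * (1 - cexp (-(ω₂ * t))))) =O[atTop] fun t => rexp (-a * t) := by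
    by_cases hz0 : z = 0
    · have h₁₂ : a ≤ (ω₁ + ω₂).re := by rw [add_re]; linarith
      refine (((exp_neg_mul_isBigO h₁).add (exp_neg_mul_isBigO h₂)).sub
        (exp_neg_mul_isBigO h₁₂)).congr_left fun t => ?_
      have : cexp (-((ω₁ + ω₂) * t)) = cexp (-(ω₁ * t)) * cexp (-(ω₂ * t)) := by
        rw [← Complex.exp_add]
        ring_nf
      simp only [hz0, if_true, this, zero_mul, neg_zero, Complex.exp_zero]
      ring
    · simpa [hz0] using exp_neg_mul_isBigO (hz.resolve_left hz0)
  have hpow : (fun t : ℝ => (t : ℂ) ^ (-2 : ℂ)) =O[atTop] fun _ => (1 : ℝ) := by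
    refine IsBigO.of_bound 1 ?_
    filter_upwards [eventually_ge_atTop 1] with t ht
    rw [norm_cpow_eq_rpow_re_of_pos (by linarith), norm_one, one_mul]
    exact Real.rpow_le_one_of_one_le_of_nonpos ht (by simp)
  have hK : barnesKernel z ω₁ ω₂ =O[atTop] fun t => rexp (-a * t) := by
    refine (hnum.mul hden).congr' ?_ (by simp)
    filter_upwards [eventually_gt_atTop 0] with t ht
    have hne := mul_ne_zero (one_sub_exp_neg_mul_ne_zero (ha.trans_le h₁) ht)
      (one_sub_exp_neg_mul_ne_zero (ha.trans_le h₂) ht)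
    rw [barnesKernel, ← div_eq_mul_inv, sub_div, mul_div_cancel_right₀ _ hne]
  have hE := (hpow.mul (exp_neg_mul_isBigO (w := 1) (a := a) (by simpa using ha1))).const_mul_left
    (ω₁ * ω₂)⁻¹
  simp only [one_mul] at hE
  exact (hK.sub hE).congr_left fun t => by rw [barnesRemainder, one_mul]

theorem barnesRemainder_isBigO_nhdsGT_zero {z ω₁ ω₂ : ℂ} (h₁ : 0 < ω₁.re) (h₂ : 0 < ω₂.re) :
    barnesRemainder z ω₁ ω₂ =O[𝓝[>] 0] (· ^ (-1 : ℝ)) := by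
  have hω₁ : ω₁ ≠ 0 := fun h => by simp [h] at h₁
  have hω₂ : ω₂ ≠ 0 := fun h => by simp [h] at h₂
  set f : ℂ → ℂ → ℂ := fun ω u => 1 - cexp (-(ω * u)) with hf
  have hderiv : ∀ ω, HasDerivAt (f ω) ω 0 := fun ω => by
    have := ((((hasDerivAt_id (0 : ℂ)).const_mul ω).neg).cexp).const_sub 1
    simpa using! this
  have hd : ∀ ω, DifferentiableAt ℂ (dslope (f ω) 0) 0 := fun ω =>
    ((differentiableOn_dslope univ_mem).2
      (by rw [hf]; fun_prop : DifferentiableOn ℂ (f ω) univ)).differentiableAt univ_mem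
  have hd0 : ∀ ω, dslope (f ω) 0 0 = ω := fun ω => by rw [dslope_same, (hderiv ω).deriv]
  set k : ℂ → ℂ := fun u => cexp (-(z * u)) / (dslope (f ω₁) 0 u * dslope (f ω₂) 0 u) -
    (ω₁ * ω₂)⁻¹ * cexp (-u) with hk
  have hkd : DifferentiableAt ℂ k 0 := by
    refine (DifferentiableAt.div (by fun_prop) ((hd ω₁).mul (hd ω₂)) ?_).sub (by fun_prop)
    rw [Pi.mul_apply, hd0, hd0]
    exact mul_ne_zero hω₁ hω₂
  have hk0 : k 0 = 0 := by
    simp only [hk, hd0]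
    simp
  have hkO : (fun t : ℝ => k t) =O[𝓝[>] 0] fun t : ℝ => t := by
    have h := hkd.isBigO_sub
    simp only [hk0, sub_zero] at h
    have ht : Tendsto (fun t : ℝ => (t : ℂ)) (𝓝[>] 0) (𝓝 0) := by
      simpa using (continuous_ofReal.tendsto (0 : ℝ)).mono_left nhdsWithin_le_nhds
    exact (h.comp_tendsto ht).trans (IsBigO.of_bound 1 (by simp))
  have hmain : (fun t : ℝ => k t * ((t : ℂ) ^ 2)⁻¹) =O[𝓝[>] 0] (· ^ (-1 : ℝ)) := by
    have h2 : (fun t : ℝ => ((t : ℂ) ^ 2)⁻¹) =O[𝓝[>] 0] fun t : ℝ => (t ^ 2)⁻¹ :=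
      IsBigO.of_bound 1 (by simp)
    refine (hkO.mul h2).congr' EventuallyEq.rfl ?_
    filter_upwards [self_mem_nhdsWithin] with t ht
    have ht' : t ≠ 0 := ne_of_gt ht
    rw [Real.rpow_neg_one]
    field_simp
  have hconst : (fun _ : ℝ => if z = 0 then (1 : ℂ) else 0) =O[𝓝[>] 0] (· ^ (-1 : ℝ)) := by
    refine IsBigO.of_bound 1 ?_
    filter_upwards [Ioo_mem_nhdsGT (zero_lt_one' ℝ)] with t ht
    rw [Real.rpow_neg_one, norm_inv, Real.norm_of_nonneg ht.1.le, one_mul]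
    have h1 : 1 ≤ t⁻¹ := (one_le_inv₀ ht.1).2 ht.2.le
    split_ifs
    · simpa using h1
    · simpa using ht.1.le
  refine (hmain.sub hconst).congr' ?_ EventuallyEq.rfl
  filter_upwards [self_mem_nhdsWithin] with t ht
  have ht' : (t : ℂ) ≠ 0 := ofReal_ne_zero.2 (ne_of_gt ht)
  have hslope : ∀ ω, 1 - cexp (-(ω * t)) = t * dslope (f ω) 0 t := fun ω => by
    have := sub_smul_dslope (f ω) 0 (t : ℂ)
    simpa [hf] using this.symm
  have hpow : (t : ℂ) ^ (-2 : ℂ) = ((t : ℂ) ^ 2)⁻¹ := by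
    rw [Complex.cpow_neg]
    norm_num
  rw [barnesRemainder, barnesKernel, hslope ω₁, hslope ω₂, hpow, hk, one_mul]
  simp only [div_eq_mul_inv, mul_inv]
  ring

/-- For frequencies in the right half-plane, `(s - 2) ζ₂(s, z | ω₁, ω₂)` extends holomorphically to
`Re s > 1` with value `1 / (ω₁ω₂)` at `s = 2`. -/
theorem exists_extension_of_re_pos {z ω₁ ω₂ : ℂ} (h₁ : 0 < ω₁.re) (h₂ : 0 < ω₂.re)
    (hz : z = 0 ∨ 0 < z.re) :
    ∃ G : ℂ → ℂ, DifferentiableOn ℂ G {s | 1 < s.re} ∧ G 2 = (ω₁ * ω₂)⁻¹ ∧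
      ∀ s : ℂ, 2 < s.re → (s - 2) * barnesZeta2 s z ω₁ ω₂ = G s := by
  obtain ⟨a, ha, ha1, ha₁, ha₂, haz⟩ : ∃ a : ℝ, 0 < a ∧ a ≤ 1 ∧ a ≤ ω₁.re ∧ a ≤ ω₂.re ∧
      (z = 0 ∨ a ≤ z.re) := by
    rcases hz with hz | hz
    · exact ⟨min 1 (min ω₁.re ω₂.re), by positivity, by simp, by simp, by simp, Or.inl hz⟩
    · exact ⟨min (min 1 z.re) (min ω₁.re ω₂.re), by positivity, by simp, by simp, by simp,
        Or.inr (by simp)⟩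
  have hloc := (continuousOn_barnesRemainder (z := z) h₁ h₂).locallyIntegrableOn
    (μ := volume) measurableSet_Ioi
  have htop := barnesRemainder_isBigO_atTop ha ha1 ha₁ ha₂ haz
  have hbot := barnesRemainder_isBigO_nhdsGT_zero (z := z) h₁ h₂
  refine ⟨fun s => ((ω₁ * ω₂)⁻¹ * Complex.Gamma (s - 1) +
    (s - 2) * mellin (barnesRemainder z ω₁ ω₂) s) * (Complex.Gamma s)⁻¹, ?_, ?_, ?_⟩
  · intro s hs
    have hs : 1 < s.re := hs
    refine DifferentiableAt.differentiableWithinAt ?_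
    have hM := mellin_differentiableAt_of_isBigO_rpow_exp ha hloc htop hbot hs
    have hG : DifferentiableAt ℂ (fun s => Complex.Gamma (s - 1)) s := by
      refine DifferentiableAt.comp s (Complex.differentiableAt_Gamma (s - 1) fun m h => ?_)
        (by fun_prop)
      have := congr_arg Complex.re h
      simp only [sub_re, one_re, neg_re, natCast_re] at this
      linarith [Nat.cast_nonneg (α := ℝ) m]
    have hG' := Complex.differentiable_one_div_Gamma s
    exact ((hG.const_mul _).add (DifferentiableAt.mul (by fun_prop) hM)).mul hG'
  · norm_num
  · intro s hs
    have hs1 : s - 2 ≠ 0 := fun h => by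
      have := congr_arg Complex.re h
      norm_num at this
      linarith
    have hs2 : 0 < (s + -2).re := by norm_num; linarith
    have hG0 : Complex.Gamma s ≠ 0 := Complex.Gamma_ne_zero_of_re_pos (by linarith)
    have hRconv := mellinConvergent_of_isBigO_rpow_exp ha hloc htop hbot (s := s) (by linarith)
    have hexp : MellinConvergent (fun t : ℝ => cexp (-(1 * t))) (s + -2) := by
      simpa only [MellinConvergent, smul_eq_mul] using!
        integrableOn_cpow_mul_exp_neg_mul_Ioi hs2 (w := 1) (by simp)
    have hexpval : mellin (fun t : ℝ => cexp (-(1 * t))) (s + -2) = Complex.Gamma (s + -2) := by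
      simp only [mellin, smul_eq_mul]
      rw [integral_cpow_mul_exp_neg_complex_mul_Ioi_s12 hs2 (by simp)]
      simp
    have hE := hasMellin_const_smul (MellinConvergent.cpow_smul.2 hexp) ((ω₁ * ω₂)⁻¹)
    have hadd := (hasMellin_add hRconv hE.1).2
    rw [hE.2, mellin_cpow_smul, hexpval] at hadd
    have hfun : (fun t : ℝ => barnesRemainder z ω₁ ω₂ t +
        (ω₁ * ω₂)⁻¹ • (t : ℂ) ^ (-2 : ℂ) • cexp (-(1 * t))) = barnesKernel z ω₁ ω₂ := by
      funext t
      simp [barnesRemainder]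
    rw [hfun] at hadd
    have hw : ∀ p : ℕ × ℕ, z + (p.1 : ℂ) * ω₁ + (p.2 : ℂ) * ω₂ = 0 ∨
        a / 3 * ((p.1 : ℝ) + p.2 + 2) ≤ (z + (p.1 : ℂ) * ω₁ + (p.2 : ℂ) * ω₂).re := by
      intro p
      have hp₁ := mul_le_mul_of_nonneg_left ha₁ (Nat.cast_nonneg (α := ℝ) p.1)
      have hp₂ := mul_le_mul_of_nonneg_left ha₂ (Nat.cast_nonneg (α := ℝ) p.2)
      have hp₁' := mul_nonneg (Nat.cast_nonneg (α := ℝ) p.1) ha.le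
      have hp₂' := mul_nonneg (Nat.cast_nonneg (α := ℝ) p.2) ha.le
      simp only [add_re, mul_re, natCast_re, natCast_im, zero_mul, sub_zero]
      rcases haz with rfl | haz
      · by_cases hp : p = (0, 0)
        · left
          simp [hp]
        · right
          have h1 : 1 ≤ p.1 + p.2 := by
            by_contra! h
            exact hp (Prod.ext (by simp; omega) (by simp; omega))
          have h1' : (1 : ℝ) ≤ (p.1 : ℝ) + p.2 := by exact_mod_cast h1
          rw [zero_re]
          nlinarith
      · right
        nlinarith
    have hsum := (hasSum_mellin_exp (by positivity : 0 < a / 3) hw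
      (fun t ht => hasSum_barnesKernel h₁ h₂ hz ht) hs).tsum_eq
    rw [tsum_mul_right, hadd] at hsum
    have hrec : Complex.Gamma (s - 1) = (s - 2) * Complex.Gamma (s + -2) := by
      rw [← sub_eq_add_neg, ← Complex.Gamma_add_one (s - 2) hs1]
      ring_nf
    change (s - 2) * (∑' p : ℕ × ℕ, _) = (_ * _⁻¹ : ℂ)
    rw [← div_eq_mul_inv, eq_div_iff hG0, mul_assoc, hsum, hrec, smul_eq_mul]
    ring

theorem tsum_prod_eq_zero_of_forall_fst {α β : Type*} [Infinite α] (g : β → ℂ) :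
    ∑' p : α × β, g p.2 = 0 := by
  by_cases hg : ∀ n, g n = 0
  · simp [hg]
  · push Not at hg
    obtain ⟨n, hn⟩ := hg
    refine tsum_eq_zero_of_not_summable fun h => hn ?_
    exact (summable_const_iff (β := α) _).1 (h.comp_injective (Prod.mk_left_injective n))

theorem tsum_prod_eq_zero_of_forall_snd {α β : Type*} [Infinite β] (g : α → ℂ) :
    ∑' p : α × β, g p.1 = 0 := by
  rw [← (Equiv.prodComm β α).tsum_eq]
  exact tsum_prod_eq_zero_of_forall_fst g

theorem barnesZeta2_eq_zero_of_eq_zero {z ω₁ ω₂ : ℂ} (h : ω₁ = 0 ∨ ω₂ = 0) (s : ℂ) :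
    barnesZeta2 s z ω₁ ω₂ = 0 := by
  rcases h with rfl | rfl
  · simpa [barnesZeta2] using
      tsum_prod_eq_zero_of_forall_fst (α := ℕ) fun n : ℕ => (z + (n : ℂ) * ω₂) ^ (-s)
  · simpa [barnesZeta2] using
      tsum_prod_eq_zero_of_forall_snd (β := ℕ) fun n : ℕ => (z + (n : ℂ) * ω₁) ^ (-s)

/-- The closed sector `{|Im v| ≤ K Re v}` around the positive real axis. -/
def slopeSector (K : ℝ) : AddSubmonoid ℂ where
  carrier := {v | 0 ≤ v.re ∧ |v.im| ≤ K * v.re}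
  zero_mem' := by simp
  add_mem' := by
    rintro v w ⟨hv, hv'⟩ ⟨hw, hw'⟩
    refine ⟨by simpa using add_nonneg hv hw, ?_⟩
    rw [add_im, add_re]
    linarith [abs_add_le v.im w.im]

theorem re_pos_of_mem_slopeSector {K : ℝ} {v : ℂ} (hv : v ∈ slopeSector K) (h0 : v ≠ 0) :
    0 < v.re := by
  refine lt_of_le_of_ne hv.1 fun h => h0 (Complex.ext h.symm ?_)
  have := hv.2
  rw [← h, mul_zero] at this
  simpa using this

theorem abs_arg_le_of_mem_slopeSector {δ : ℝ} (hδ0 : 0 ≤ δ) (hδ : δ < π / 2) {v : ℂ}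
    (hv : v ∈ slopeSector (Real.tan δ)) : |v.arg| ≤ δ := by
  by_cases h0 : v = 0
  · simpa [h0] using hδ0
  have hre := re_pos_of_mem_slopeSector hv h0
  have harg := abs_lt.1 (abs_arg_lt_pi_div_two_iff.2 (Or.inl hre))
  have htan : |Real.tan v.arg| ≤ Real.tan δ := by
    rw [tan_arg, abs_div, abs_of_pos hre]
    exact (div_le_iff₀ hre).2 hv.2
  have hδm : δ ∈ Ioo (-(π / 2)) (π / 2) := ⟨by linarith, hδ⟩
  have hδn : -δ ∈ Ioo (-(π / 2)) (π / 2) := ⟨by linarith, by linarith [pi_pos]⟩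
  refine abs_le.2 ⟨(Real.strictMonoOn_tan.le_iff_le hδn harg).1 ?_,
    (Real.strictMonoOn_tan.le_iff_le harg hδm).1 (abs_le.1 htan).2⟩
  rw [Real.tan_neg]
  exact (abs_le.1 htan).1

theorem mul_exp_mem_slopeSector {δ θ : ℝ} (hδ : δ < π / 2) {v : ℂ}
    (hv : |v.arg - θ| ≤ δ) : v * cexp (-(θ * I)) ∈ slopeSector (Real.tan δ) := by
  have hδ0 := (abs_nonneg _).trans hv
  have hpolar : v * cexp (-(θ * I)) = (‖v‖ : ℂ) * cexp ((v.arg - θ : ℝ) * I) := by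
    conv_lhs => rw [← norm_mul_exp_arg_mul_I v]
    rw [mul_assoc, ← Complex.exp_add]
    congr 2
    push_cast
    ring
  have hφ := abs_le.1 hv
  have hcos : 0 < Real.cos (v.arg - θ) := Real.cos_pos_of_mem_Ioo ⟨by linarith, by linarith⟩
  have hcosδ : 0 < Real.cos δ := Real.cos_pos_of_mem_Ioo ⟨by linarith, hδ⟩
  have hsin : |Real.sin (v.arg - θ)| ≤ Real.tan δ * Real.cos (v.arg - θ) := by
    rw [Real.tan_eq_sin_div_cos, div_mul_eq_mul_div, le_div_iff₀ hcosδ,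
      Real.abs_sin_eq_sin_abs_of_abs_le_pi (by linarith), ← Real.cos_abs (v.arg - θ)]
    have := Real.sin_nonneg_of_nonneg_of_le_pi (x := δ - |v.arg - θ|) (by linarith)
      (by linarith [abs_nonneg (v.arg - θ)])
    rw [Real.sin_sub] at this
    linarith
  have hre : (v * cexp (-(θ * I))).re = ‖v‖ * Real.cos (v.arg - θ) := by
    rw [hpolar, re_ofReal_mul, exp_ofReal_mul_I_re]
  have him : (v * cexp (-(θ * I))).im = ‖v‖ * Real.sin (v.arg - θ) := by
    rw [hpolar, im_ofReal_mul, exp_ofReal_mul_I_im]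
  refine ⟨?_, ?_⟩
  · rw [hre]
    positivity
  · rw [hre, him, abs_mul, abs_norm, mul_left_comm]
    gcongr

theorem exp_mul_I_mul_cpow_neg {θ : ℝ} {v s : ℂ} (hs : s ≠ 0) (h₁ : -π < θ + v.arg)
    (h₂ : θ + v.arg ≤ π) :
    (cexp (θ * I) * v) ^ (-s) = cexp (-(θ * I * s)) * v ^ (-s) := by
  by_cases hv : v = 0
  · simp [hv, zero_cpow (neg_ne_zero.2 hs)]
  have him : (θ * I + Complex.log v).im = θ + v.arg := by simp [log_im]
  have hexp : cexp (θ * I) * v = cexp (θ * I + Complex.log v) := by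
    rw [Complex.exp_add, exp_log hv]
  rw [cpow_def_of_ne_zero hv, hexp, cpow_def_of_ne_zero (Complex.exp_ne_zero _),
    Complex.log_exp (by rwa [him]) (by rwa [him]), ← Complex.exp_add]
  ring_nf

/-- If all parameters lie in a sector of opening less than `π` inside the principal range, then
`(s - 2) ζ₂(s, z | ω₁, ω₂)` extends holomorphically to `Re s > 1` with value `1 / (ω₁ω₂)`
at `s = 2`. -/
theorem exists_extension_of_mem_Icc_arg {z ω₁ ω₂ : ℂ} {α β : ℝ} (hα : -π < α) (hβ : β ≤ π)
    (hαβ : β - α < π) (hz : z.arg ∈ Icc α β) (hω₁ : ω₁.arg ∈ Icc α β) (hω₂ : ω₂.arg ∈ Icc α β) :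
    ∃ G : ℂ → ℂ, DifferentiableOn ℂ G {s | 1 < s.re} ∧ G 2 = (ω₁ * ω₂)⁻¹ ∧
      ∀ s : ℂ, 2 < s.re → (s - 2) * barnesZeta2 s z ω₁ ω₂ = G s := by
  by_cases h0 : ω₁ = 0 ∨ ω₂ = 0
  · refine ⟨fun _ => 0, differentiableOn_const _, ?_, fun s _ => ?_⟩
    · rw [mul_eq_zero.2 h0, inv_zero]
    · rw [barnesZeta2_eq_zero_of_eq_zero h0, mul_zero]
  push Not at h0
  obtain ⟨θ, hθ⟩ : ∃ θ, θ = (α + β) / 2 := ⟨_, rfl⟩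
  obtain ⟨δ, hδ⟩ : ∃ δ, δ = (β - α) / 2 := ⟨_, rfl⟩
  have hδ0 : 0 ≤ δ := by linarith [hz.1.trans hz.2]
  have hδπ : δ < π / 2 := by linarith
  have hmem : ∀ v : ℂ, v.arg ∈ Icc α β → v * cexp (-(θ * I)) ∈ slopeSector (Real.tan δ) :=
    fun v hv => mul_exp_mem_slopeSector hδπ <|
      abs_le.2 ⟨by linarith [hv.1], by linarith [hv.2]⟩
  have hpos : ∀ v : ℂ, v.arg ∈ Icc α β → v ≠ 0 → 0 < (v * cexp (-(θ * I))).re := fun v hv hv0 =>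
    re_pos_of_mem_slopeSector (hmem v hv) (mul_ne_zero hv0 (Complex.exp_ne_zero _))
  have hinv : cexp (θ * I) * cexp (-(θ * I)) = 1 := by rw [← Complex.exp_add]; simp
  obtain ⟨G, hG, hG2, hGs⟩ := exists_extension_of_re_pos (z := z * cexp (-(θ * I)))
    (hpos ω₁ hω₁ h0.1) (hpos ω₂ hω₂ h0.2)
    ((eq_or_ne z 0).imp (fun h => by simp [h]) (hpos z hz))
  refine ⟨fun s => cexp (-(θ * I * s)) * G s, DifferentiableOn.mul (by fun_prop) hG, ?_,
    fun s hs => ?_⟩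
  · have h2 : cexp (-(θ * I * 2)) = cexp (-(θ * I)) * cexp (-(θ * I)) := by
      rw [← Complex.exp_add]
      ring_nf
    have := Complex.exp_ne_zero (-(θ * I))
    simp only [hG2, h2]
    field_simp [h0.1, h0.2]
  · have hs0 : s ≠ 0 := fun h => by
      rw [h, zero_re] at hs
      linarith
    change _ = cexp (-(θ * I * s)) * G s
    rw [← hGs s hs, mul_left_comm, barnesZeta2, barnesZeta2, ← tsum_mul_left (a := cexp _)]
    congr 2
    funext p
    have hp : z * cexp (-(θ * I)) + (p.1 : ℂ) * (ω₁ * cexp (-(θ * I))) +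
        (p.2 : ℂ) * (ω₂ * cexp (-(θ * I))) ∈ slopeSector (Real.tan δ) := by
      rw [← nsmul_eq_mul, ← nsmul_eq_mul]
      exact add_mem (add_mem (hmem z hz) (nsmul_mem (hmem ω₁ hω₁) _)) (nsmul_mem (hmem ω₂ hω₂) _)
    have harg := abs_le.1 (abs_arg_le_of_mem_slopeSector hδ0 hδπ hp)
    rw [← exp_mul_I_mul_cpow_neg hs0 (by linarith [harg.1]) (by linarith [harg.2])]
    congr 1
    linear_combination (-(z + (p.1 : ℂ) * ω₁ + (p.2 : ℂ) * ω₂)) * hinv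

theorem isPreconnected_re_gt_one_diff_two : IsPreconnected {s : ℂ | 1 < s.re ∧ s ≠ 2} := by
  have hR : IsPreconnected {s : ℂ | 2 < s.re} := (convex_halfSpace_re_gt 2).isPreconnected
  have hL : IsPreconnected ({s : ℂ | 1 < s.re} ∩ {s | s.re < 2}) :=
    ((convex_halfSpace_re_gt 1).inter (convex_halfSpace_re_lt 2)).isPreconnected
  have hU : IsPreconnected ({s : ℂ | 1 < s.re} ∩ {s | 0 < s.im}) :=
    ((convex_halfSpace_re_gt 1).inter (convex_halfSpace_im_gt 0)).isPreconnected
  have hD : IsPreconnected ({s : ℂ | 1 < s.re} ∩ {s | s.im < 0}) :=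
    ((convex_halfSpace_re_gt 1).inter (convex_halfSpace_im_lt 0)).isPreconnected
  have h := ((hR.union ⟨3, 1⟩ (by norm_num) (by norm_num) hU).union ⟨3, -1⟩ (by norm_num)
    (by norm_num) hD).union ⟨3 / 2, 1⟩ (by norm_num) (by norm_num) hL
  convert! h using 1
  ext s
  simp only [mem_ofPred_eq, mem_union, mem_inter_iff]
  constructor
  · rintro ⟨h1, h2⟩
    rcases lt_trichotomy s.re 2 with hre | hre | hre
    · exact Or.inr ⟨h1, hre⟩
    · rcases lt_trichotomy s.im 0 with him | him | him
      · exact Or.inl (Or.inr ⟨h1, him⟩)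
      · exact absurd (Complex.ext (by simpa using hre) (by simpa using him)) h2
      · exact Or.inl (Or.inl (Or.inr ⟨h1, him⟩))
    · exact Or.inl (Or.inl (Or.inl hre))
  · rintro (((h | h) | h) | h)
    · exact ⟨by linarith, fun h2 => by norm_num [h2] at h⟩
    · exact ⟨h.1, fun h2 => by norm_num [h2] at h⟩
    · exact ⟨h.1, fun h2 => by norm_num [h2] at h⟩
    · exact ⟨h.1, fun h2 => by norm_num [h2] at h⟩

theorem one_sub_exp_pi_mul_I_mul_two_mul_nat (N : ℕ) :
    1 - cexp (π * I * ((2 * N : ℕ) : ℂ)) = 0 := by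
  rw [sub_eq_zero, eq_comm, Complex.exp_eq_one_iff]
  exact ⟨N, by push_cast; ring⟩

/-- If `F` is analytic away from `s ∈ {1, 2}` and agrees with `ζ₂(s, z | ω₁, ω₂)` for
`Re(s) > 2`, then `(1 − e^{πis}) F s → −πi/(ω₁ω₂)` as `s → 2N` when `N = 1`, and `→ 0`
when `N ≥ 2`. -/
theorem barnesZeta2_pole_limit (z ω₁ ω₂ : ℂ)
    (hOC : ∃ a b : ℝ, b - a < π ∧ (a < z.arg ∧ z.arg < b) ∧
      (a < ω₁.arg ∧ ω₁.arg < b) ∧ (a < ω₂.arg ∧ ω₂.arg < b))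
    (F : ℂ → ℂ) (hF : DifferentiableOn ℂ F {(1 : ℂ), 2}ᶜ)
    (hagree : ∀ s : ℂ, 2 < s.re → F s = barnesZeta2 s z ω₁ ω₂)
    (N : ℕ) (hN : 1 ≤ N) :
    Filter.Tendsto (fun s : ℂ => (1 - Complex.exp (π * I * s)) * F s)
      (nhdsWithin ((2 * N : ℕ) : ℂ) {((2 * N : ℕ) : ℂ)}ᶜ)
      (nhds (if N = 1 then -(π * I) / (ω₁ * ω₂) else 0)) := by
  have hzero := one_sub_exp_pi_mul_I_mul_two_mul_nat N
  have hopen : IsOpen ({(1 : ℂ), 2}ᶜ : Set ℂ) := (toFinite _).isClosed.isOpen_compl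
  split_ifs with h1
  · subst h1
    obtain ⟨a, b, hab, hz, hω₁, hω₂⟩ := hOC
    obtain ⟨G, hG, hG2, hGs⟩ := exists_extension_of_mem_Icc_arg (z := z) (ω₁ := ω₁) (ω₂ := ω₂)
      (α := min z.arg (min ω₁.arg ω₂.arg)) (β := max z.arg (max ω₁.arg ω₂.arg))
      (by simp [neg_pi_lt_arg]) (by simp [arg_le_pi])
      (by
        have h1 : a < min z.arg (min ω₁.arg ω₂.arg) := by simp [hz.1, hω₁.1, hω₂.1]
        have h2 : max z.arg (max ω₁.arg ω₂.arg) < b := by simp [hz.2, hω₁.2, hω₂.2]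
        linarith)
      (by simp) (by simp) (by simp)
    have hsub : {s : ℂ | 1 < s.re ∧ s ≠ 2} ⊆ {(1 : ℂ), 2}ᶜ := fun s hs h => by
      rcases h with rfl | rfl
      · simp at hs
      · exact hs.2 rfl
    have hDopen : IsOpen {s : ℂ | 1 < s.re} := isOpen_lt continuous_const continuous_re
    have heq : EqOn (fun s => (s - 2) * F s) G {s : ℂ | 1 < s.re ∧ s ≠ 2} := by
      refine AnalyticOnNhd.eqOn_of_preconnected_of_eventuallyEq (z₀ := 3)
        (DifferentiableOn.analyticOnNhd ?_ (hDopen.inter isOpen_ne))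
        ((hG.mono fun s hs => hs.1).analyticOnNhd (hDopen.inter isOpen_ne))
        isPreconnected_re_gt_one_diff_two (by norm_num) ?_
      · exact DifferentiableOn.mul (by fun_prop) (hF.mono hsub)
      · filter_upwards [(isOpen_lt continuous_const continuous_re).mem_nhds
          (show (2 : ℝ) < (3 : ℂ).re by norm_num)] with s hs
        rw [← hGs s hs, hagree s hs]
    have hGt : Tendsto G (𝓝[≠] 2) (𝓝 (ω₁ * ω₂)⁻¹) := by
      rw [← hG2]
      exact ((hG.differentiableAt (hDopen.mem_nhds
        (by norm_num : (1 : ℝ) < (2 : ℂ).re))).continuousAt.tendsto).mono_left nhdsWithin_le_nhds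
    have hder : HasDerivAt (fun s : ℂ => 1 - cexp (π * I * s)) (-(π * I)) 2 := by
      have := (((hasDerivAt_id (2 : ℂ)).const_mul (π * I)).cexp).const_sub 1
      have h2 : cexp (π * I * 2) = 1 := by
        have := one_sub_exp_pi_mul_I_mul_two_mul_nat 1
        rw [sub_eq_zero] at this
        simpa using this.symm
      simpa [h2] using! this
    have hlim := (hasDerivAt_iff_tendsto_slope.1 hder).mul hGt
    have hcast : ((2 * 1 : ℕ) : ℂ) = 2 := by norm_num
    rw [hcast] at hzero ⊢
    rw [div_eq_mul_inv]
    refine hlim.congr' ?_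
    filter_upwards [self_mem_nhdsWithin,
      nhdsWithin_le_nhds (hDopen.mem_nhds (by norm_num : (1 : ℝ) < (2 : ℂ).re))] with s hs hs'
    have hs2 : s - 2 ≠ 0 := sub_ne_zero.2 hs
    rw [← heq ⟨hs', hs⟩, slope_def_field, hzero]
    field_simp
    ring
  · have hmem : ((2 * N : ℕ) : ℂ) ∈ ({(1 : ℂ), 2}ᶜ : Set ℂ) := by
      rintro (h | h)
      · have : 2 * N = 1 := by exact_mod_cast h
        omega
      · have : 2 * N = 2 := by exact_mod_cast mem_singleton_iff.1 h
        omega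
    have hFc := (hF.differentiableAt (hopen.mem_nhds hmem)).continuousAt
    have hE : ContinuousAt (fun s : ℂ => 1 - cexp (π * I * s)) ((2 * N : ℕ) : ℂ) := by fun_prop
    have := (hE.mul hFc).tendsto.mono_left (nhdsWithin_le_nhds (s := {((2 * N : ℕ) : ℂ)}ᶜ))
    simpa only [Pi.mul_apply, hzero, zero_mul] using! this
end

section
/- (Ramanujan's formula) For τ in the upper half-plane and any positive integer N: ½ζ(2N+1) + Σ_{n≥1} n^{-(2N+1)} e^{2πinτ}/(1 − e^{2πinτ}) = τ^{2N} [½ζ(2N+1) + Σ_{n≥1} n^{-(2N+1)} e^{−2πin/τ}/(1 − e^{−2πin/τ})] + ½ (2πi)^{2N+1}/(2N+2)! · B_{2,2N+2}(0 | τ, 1). -/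
open Complex Real

/-- The power series of `e^{wt}` in `t`. -/
noncomputable def expPS (w : ℂ) : PowerSeries ℂ :=
  PowerSeries.mk fun n => w ^ n / n.factorial

/-- `B n = B_{r,n}(z | ω)` iff the generating-function identity
`t^r e^{zt} = (∏_k (e^{ω_k t} - 1)) · Σ_n B n t^n/n!` holds. -/
def IsMultBernoulli (r : ℕ) (z : ℂ) (ω : Fin r → ℂ) (B : ℕ → ℂ) : Prop :=
  (∏ k, (expPS (ω k) - 1)) * PowerSeries.mk (fun n => B n / n.factorial)
    = (PowerSeries.X : PowerSeries ℂ) ^ r * expPS z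

/-- The nome quotient `q / (1 - q)` in terms of the cotangent. -/
lemma exp_div_one_sub_exp_eq_cot {x : ℂ} (hx : Complex.exp (2 * π * I * x) ≠ 1) :
    Complex.exp (2 * π * I * x) / (1 - Complex.exp (2 * π * I * x))
      = -(1 / 2) + I / 2 * Complex.cot (π * x) := by
  rw [Complex.cot_pi_eq_exp_ratio]
  have h : 1 - Complex.exp (2 * π * I * x) ≠ 0 := sub_ne_zero.mpr hx.symm
  field_simp
  ring

lemma exp_two_pi_I_mul_ne_one {x : ℂ} (hx : 0 < x.im) : Complex.exp (2 * π * I * x) ≠ 1 := by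
  intro h
  obtain ⟨k, hk⟩ := Complex.exp_eq_one_iff.mp h
  have h2 : x = k := by
    have h3 : (2 * π * I : ℂ) ≠ 0 := Complex.two_pi_I_ne_zero
    apply mul_left_cancel₀ h3
    rw [hk]; ring
  simp [h2] at hx

/-- Mittag-Leffler expansion of `q / (1 - q)`. -/
lemma exp_div_one_sub_exp_eq_tsum {x : ℂ} (hx : 0 < x.im) :
    Complex.exp (2 * π * I * x) / (1 - Complex.exp (2 * π * I * x))
      = -(1 / 2) + I / (2 * π) *
        (1 / x + 2 * x * ∑' m : ℕ, 1 / (x ^ 2 - ((m : ℂ) + 1) ^ 2)) := by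
  have hxc : x ∈ Complex.integerComplement := by
    rintro ⟨k, rfl⟩
    simp at hx
  have h := cot_series_rep' hxc
  rw [exp_div_one_sub_exp_eq_cot (exp_two_pi_I_mul_ne_one hx), ← tsum_mul_left]
  have h2 : ∀ m : ℕ, 2 * x * (1 / (x ^ 2 - ((m : ℂ) + 1) ^ 2))
      = 1 / (x - (m + 1)) + 1 / (x + (m + 1)) := fun m ↦ by
    have := cotTerm_identity hxc m
    rw [cotTerm] at this
    rw [this]
    ring_nf
  have hpi : (π : ℂ) ≠ 0 := by exact_mod_cast Real.pi_ne_zero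
  rw [tsum_congr h2, ← h]
  field_simp
  ring

lemma norm_mul_sub_mul_ge (w : ℂ) (hw : 0 < w.im) (s t : ℝ) :
    |t| * (w.im / ‖w‖) ≤ ‖(s : ℂ) * w - t‖ := by
  have hw0 : 0 < ‖w‖ := norm_pos_iff.mpr (by rintro rfl; simp at hw)
  rw [← mul_div_assoc, div_le_iff₀ hw0, ← RCLike.norm_conj w, ← norm_mul]
  refine le_trans (le_of_eq ?_) (Complex.abs_im_le_norm _)
  have : (((s : ℂ) * w - t) * (starRingEnd ℂ) w).im = t * w.im := by
    simp; ring
  rw [this, abs_mul, abs_of_pos hw]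

lemma norm_sq_mul_sq_sub_sq_ge (w : ℂ) (hw : 0 < w.im) (s t : ℝ) :
    t ^ 2 * (w.im / ‖w‖) ^ 2 ≤ ‖(s : ℂ) ^ 2 * w ^ 2 - (t : ℂ) ^ 2‖ := by
  have h1 := norm_mul_sub_mul_ge w hw s t
  have h2 := norm_mul_sub_mul_ge w hw s (-t)
  rw [show (s : ℂ) ^ 2 * w ^ 2 - (t : ℂ) ^ 2 = (s * w - t) * (s * w - (-t : ℝ)) by
    push_cast; ring, norm_mul]
  rw [abs_neg] at h2
  calc t ^ 2 * (w.im / ‖w‖) ^ 2 = (|t| * (w.im / ‖w‖)) * (|t| * (w.im / ‖w‖)) := by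
        rw [← sq_abs t]; ring
    _ ≤ _ := mul_le_mul h1 h2 (by positivity) (by positivity)

lemma sq_mul_sq_sub_sq_ne_zero (w : ℂ) (hw : 0 < w.im) (n m : ℕ) :
    ((n : ℂ) + 1) ^ 2 * w ^ 2 - ((m : ℂ) + 1) ^ 2 ≠ 0 := by
  have h := norm_sq_mul_sq_sub_sq_ge w hw (n + 1) (m + 1)
  have hw0 : 0 < ‖w‖ := norm_pos_iff.mpr (by rintro rfl; simp at hw)
  push_cast at h
  refine norm_pos_iff.mp (lt_of_lt_of_le ?_ h)
  positivity

lemma summable_one_div_nat_add_one_pow {k : ℕ} (hk : 1 < k) :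
    Summable fun n : ℕ ↦ 1 / ((n : ℂ) + 1) ^ k := by
  have := (summable_nat_add_iff 1).mpr (Real.summable_one_div_nat_pow.mpr hk)
  rw [← summable_norm_iff]
  refine this.congr fun n ↦ ?_
  rw [norm_div, norm_pow, norm_one]
  norm_cast

lemma riemannZeta_nat_eq_tsum_add_one {k : ℕ} (hk : 1 < k) :
    riemannZeta k = ∑' n : ℕ, 1 / ((n : ℂ) + 1) ^ k := by
  rw [zeta_eq_tsum_one_div_nat_add_one_cpow (by simpa using hk)]
  simp only [Complex.cpow_natCast]

lemma summable_one_div_pow_mul_one_div_pow {k l : ℕ} (hk : 1 < k) (hl : 1 < l) :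
    Summable fun p : ℕ × ℕ ↦ 1 / ((p.1 : ℂ) + 1) ^ k * (1 / ((p.2 : ℂ) + 1) ^ l) :=
  summable_mul_of_summable_norm (f := fun n : ℕ ↦ 1 / ((n : ℂ) + 1) ^ k)
    (g := fun n : ℕ ↦ 1 / ((n : ℂ) + 1) ^ l)
    (summable_one_div_nat_add_one_pow hk).norm (summable_one_div_nat_add_one_pow hl).norm

lemma riemannZeta_mul_riemannZeta_eq_tsum {k l : ℕ} (hk : 1 < k) (hl : 1 < l) :
    riemannZeta k * riemannZeta l
      = ∑' p : ℕ × ℕ, 1 / ((p.1 : ℂ) + 1) ^ k * (1 / ((p.2 : ℂ) + 1) ^ l) := by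
  rw [riemannZeta_nat_eq_tsum_add_one hk, riemannZeta_nat_eq_tsum_add_one hl]
  exact tsum_mul_tsum_of_summable_norm (summable_one_div_nat_add_one_pow hk).norm
    (summable_one_div_nat_add_one_pow hl).norm

lemma summable_one_div_pow_mul_one_div_sq_sub_sq {N : ℕ} (hN : 1 ≤ N) (w : ℂ) (hw : 0 < w.im) :
    Summable fun p : ℕ × ℕ ↦ 1 / ((p.1 : ℂ) + 1) ^ (2 * N) *
      (1 / (((p.1 : ℂ) + 1) ^ 2 * w ^ 2 - ((p.2 : ℂ) + 1) ^ 2)) := by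
  have hw0 : 0 < ‖w‖ := norm_pos_iff.mpr (by rintro rfl; simp at hw)
  have hs := (summable_one_div_pow_mul_one_div_pow (k := 2 * N) (l := 2)
    (by lia) (by lia)).norm.mul_right (((w.im / ‖w‖) ^ 2)⁻¹)
  refine Summable.of_norm_bounded hs fun p ↦ ?_
  rw [norm_mul, norm_mul, mul_assoc]
  gcongr
  have h := norm_sq_mul_sq_sub_sq_ge w hw (p.1 + 1) (p.2 + 1)
  push_cast at h
  have h2 : ‖((p.2 : ℂ) + 1)‖ = p.2 + 1 := by norm_cast
  rw [norm_div, norm_div, norm_one, norm_pow, h2, one_div, one_div, ← mul_inv]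
  gcongr

/-- The Lambert series, completed by half a zeta value, as a double series. -/
lemma half_riemannZeta_add_tsum_eq {N : ℕ} (hN : 1 ≤ N) (w : ℂ) (hw : 0 < w.im) :
    (1 / 2) * riemannZeta (2 * N + 1)
      + ∑' n : ℕ, (1 / ((n : ℂ) + 1) ^ (2 * N + 1)) *
          (Complex.exp (2 * π * I * ((n : ℂ) + 1) * w)
            / (1 - Complex.exp (2 * π * I * ((n : ℂ) + 1) * w)))
    = I / (2 * π) * (riemannZeta (2 * N + 2) / w + 2 * w *
        ∑' p : ℕ × ℕ, 1 / ((p.1 : ℂ) + 1) ^ (2 * N) *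
          (1 / (((p.1 : ℂ) + 1) ^ 2 * w ^ 2 - ((p.2 : ℂ) + 1) ^ 2))) := by
  have hw0 : w ≠ 0 := by rintro rfl; simp at hw
  have hD := summable_one_div_pow_mul_one_div_sq_sub_sq hN w hw
  have hterm : ∀ n : ℕ, (1 / ((n : ℂ) + 1) ^ (2 * N + 1)) *
          (Complex.exp (2 * π * I * ((n : ℂ) + 1) * w)
            / (1 - Complex.exp (2 * π * I * ((n : ℂ) + 1) * w)))
      = -(1 / 2) * (1 / ((n : ℂ) + 1) ^ (2 * N + 1))
        + (I / (2 * π) / w * (1 / ((n : ℂ) + 1) ^ (2 * N + 2))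
        + I / (2 * π) * (2 * w) * ∑' m : ℕ, 1 / ((n : ℂ) + 1) ^ (2 * N) *
          (1 / (((n : ℂ) + 1) ^ 2 * w ^ 2 - ((m : ℂ) + 1) ^ 2))) := fun n ↦ by
    have him : 0 < (((n : ℂ) + 1) * w).im := by
      have : (((n : ℂ) + 1) * w).im = (n + 1) * w.im := by simp
      rw [this]; positivity
    have hn : (n : ℂ) + 1 ≠ 0 := by exact_mod_cast n.succ_ne_zero
    have hpi : (π : ℂ) ≠ 0 := by exact_mod_cast Real.pi_ne_zero
    rw [mul_assoc (2 * π * I : ℂ), exp_div_one_sub_exp_eq_tsum him, tsum_mul_left, mul_pow]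
    generalize (∑' m : ℕ, 1 / (((n : ℂ) + 1) ^ 2 * w ^ 2 - ((m : ℂ) + 1) ^ 2)) = S
    field_simp
    ring
  have h1 := (summable_one_div_nat_add_one_pow (k := 2 * N + 1) (by lia)).mul_left (-(1 / 2) : ℂ)
  have h2 := (summable_one_div_nat_add_one_pow (k := 2 * N + 2) (by lia)).mul_left
    (I / (2 * π) / w)
  have h3 := hD.prod.mul_left (I / (2 * π) * (2 * w))
  rw [tsum_congr hterm, h1.tsum_add (h2.add h3), h2.tsum_add h3, tsum_mul_left, tsum_mul_left,
    tsum_mul_left, hD.tsum_prod, ← riemannZeta_nat_eq_tsum_add_one (k := 2 * N + 1) (by lia),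
    ← riemannZeta_nat_eq_tsum_add_one (k := 2 * N + 2) (by lia)]
  push_cast
  ring

/-- Partial fractions: the finite sum behind the period polynomial. -/
lemma partial_fraction_sum {N : ℕ} {w a b : ℂ} (ha : a ≠ 0) (hb : b ≠ 0)
    (hab : a ^ 2 * w ^ 2 - b ^ 2 ≠ 0) :
    1 / a ^ (2 * N) * (1 / (a ^ 2 * w ^ 2 - b ^ 2))
      - w ^ (2 * N) * (1 / b ^ (2 * N) * (1 / (a ^ 2 * w ^ 2 - b ^ 2)))
      = -∑ j ∈ Finset.range N, w ^ (2 * j) * (1 / a ^ (2 * (N - j)) * (1 / b ^ (2 * (j + 1)))) := by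
  have hgeom := geom_sum₂_mul (a ^ 2 * w ^ 2) (b ^ 2) N
  have hsum : ∑ j ∈ Finset.range N, w ^ (2 * j) * (1 / a ^ (2 * (N - j)) * (1 / b ^ (2 * (j + 1))))
      = (∑ j ∈ Finset.range N, (a ^ 2 * w ^ 2) ^ j * (b ^ 2) ^ (N - 1 - j))
        / (a ^ (2 * N) * b ^ (2 * N)) := by
    rw [Finset.sum_div]
    refine Finset.sum_congr rfl fun j hj ↦ ?_
    obtain ⟨k, rfl⟩ := Nat.exists_eq_add_of_lt (Finset.mem_range.mp hj)
    rw [show j + k + 1 - j = k + 1 by lia, show j + k + 1 - 1 - j = k by lia]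
    field_simp
    ring
  rw [hsum, eq_div_of_mul_eq hab hgeom]
  field_simp
  ring

/-- The transformation law of the completed Lambert series in terms of even zeta values. -/
lemma lambert_sub_eq_sum_riemannZeta {N : ℕ} (hN : 1 ≤ N) (τ : ℂ) (hτ : 0 < τ.im) :
    (∑' p : ℕ × ℕ, 1 / ((p.1 : ℂ) + 1) ^ (2 * N) *
          (1 / (((p.1 : ℂ) + 1) ^ 2 * τ ^ 2 - ((p.2 : ℂ) + 1) ^ 2)))
      + τ ^ (2 * N) / τ ^ 2 * (∑' p : ℕ × ℕ, 1 / ((p.1 : ℂ) + 1) ^ (2 * N) *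
          (1 / (((p.1 : ℂ) + 1) ^ 2 * (-1 / τ) ^ 2 - ((p.2 : ℂ) + 1) ^ 2)))
      = -∑ j ∈ Finset.range N,
          τ ^ (2 * j) * (riemannZeta (2 * (N - j : ℕ)) * riemannZeta (2 * (j + 1 : ℕ))) := by
  have hτ0 : τ ≠ 0 := by rintro rfl; simp at hτ
  have him : 0 < (-1 / τ).im := by
    rw [neg_div, one_div, Complex.neg_im, Complex.inv_im, neg_div, neg_neg]
    exact div_pos hτ (Complex.normSq_pos.mpr hτ0)
  have hD1 := summable_one_div_pow_mul_one_div_sq_sub_sq hN τ hτ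
  have hD2 := (summable_one_div_pow_mul_one_div_sq_sub_sq hN (-1 / τ) him).prod_symm.mul_left
    (τ ^ (2 * N) / τ ^ 2)
  have hz : ∀ j ∈ Finset.range N,
      τ ^ (2 * j) * (riemannZeta (2 * (N - j : ℕ)) * riemannZeta (2 * (j + 1 : ℕ)))
      = ∑' p : ℕ × ℕ, τ ^ (2 * j) * (1 / ((p.1 : ℂ) + 1) ^ (2 * (N - j)) *
        (1 / ((p.2 : ℂ) + 1) ^ (2 * (j + 1)))) := fun j hj ↦ by
    have := Finset.mem_range.mp hj
    rw [tsum_mul_left, ← riemannZeta_mul_riemannZeta_eq_tsum (by lia) (by lia)]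
    push_cast
    rfl
  have hzs : ∀ j ∈ Finset.range N, Summable fun p : ℕ × ℕ ↦
      τ ^ (2 * j) * (1 / ((p.1 : ℂ) + 1) ^ (2 * (N - j)) *
        (1 / ((p.2 : ℂ) + 1) ^ (2 * (j + 1)))) := fun j hj ↦ by
    have := Finset.mem_range.mp hj
    exact (summable_one_div_pow_mul_one_div_pow (by lia) (by lia)).mul_left _
  rw [Finset.sum_congr rfl hz, ← Summable.tsum_finsetSum hzs, ← tsum_neg, ← tsum_mul_left,
    ← (Equiv.prodComm ℕ ℕ).tsum_eq (fun p : ℕ × ℕ ↦ τ ^ (2 * N) / τ ^ 2 * _)]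
  refine (Summable.tsum_add hD1 hD2).symm.trans ?_
  refine tsum_congr fun ⟨n, m⟩ ↦ ?_
  have hn : (n : ℂ) + 1 ≠ 0 := by exact_mod_cast n.succ_ne_zero
  have hm : (m : ℂ) + 1 ≠ 0 := by exact_mod_cast m.succ_ne_zero
  have hnm := sq_mul_sq_sub_sq_ne_zero τ hτ n m
  rw [← partial_fraction_sum hn hm hnm]
  have hmn : ((m : ℂ) + 1) ^ 2 * (-1 / τ) ^ 2 - ((n : ℂ) + 1) ^ 2
      = -((((n : ℂ) + 1) ^ 2 * τ ^ 2 - ((m : ℂ) + 1) ^ 2) / τ ^ 2) := by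
    field_simp
    ring
  simp only [Prod.fst_swap, Prod.snd_swap, hmn]
  generalize (((n : ℂ) + 1) ^ 2 * τ ^ 2 - ((m : ℂ) + 1) ^ 2) = d at *
  field_simp
  ring

lemma expPS_one : expPS 1 = PowerSeries.exp ℂ := by
  ext n
  simp [expPS, PowerSeries.coeff_exp]

lemma expPS_eq_rescale (w : ℂ) : expPS w = PowerSeries.rescale w (PowerSeries.exp ℂ) := by
  ext n
  simp [expPS, PowerSeries.coeff_exp, PowerSeries.coeff_rescale, div_eq_mul_inv]

lemma expPS_zero : expPS 0 = 1 := by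
  ext n
  rcases n with _ | n <;> simp [expPS, PowerSeries.coeff_one]

/-- Double Bernoulli numbers with periods `(τ, 1)` are convolutions of Bernoulli numbers. -/
lemma IsMultBernoulli.mul_div_factorial_eq {τ : ℂ} {B : ℕ → ℂ}
    (hB : IsMultBernoulli 2 0 ![τ, 1] B) (n : ℕ) :
    τ * (B n / n.factorial) = ∑ k ∈ Finset.range (n + 1),
      τ ^ k * (bernoulli k / k.factorial : ℂ)
        * (bernoulli (n - k) / (n - k).factorial : ℂ) := by
  have h1 := bernoulliPowerSeries_mul_exp_sub_one ℂ
  have h2 := congrArg (PowerSeries.rescale τ) h1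
  rw [map_mul, map_sub, map_one, ← expPS_eq_rescale, PowerSeries.rescale_X] at h2
  rw [← expPS_one] at h1
  simp only [IsMultBernoulli, Fin.prod_univ_two, Matrix.cons_val_zero, Matrix.cons_val_one,
    expPS_zero, mul_one] at hB
  set b := bernoulliPowerSeries ℂ
  have key : PowerSeries.C τ * PowerSeries.mk (fun n => B n / n.factorial)
      = PowerSeries.rescale τ b * b := by
    apply mul_left_cancel₀ (pow_ne_zero 2 (PowerSeries.X_ne_zero (R := ℂ)))
    rw [← hB]
    calc _ = (b * (expPS 1 - 1)) * (PowerSeries.C τ * PowerSeries.X)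
              * PowerSeries.mk (fun n => B n / n.factorial) := by
            rw [h1, hB]; ring
      _ = _ := by rw [← h2]; ring
  have := congrArg (PowerSeries.coeff n) key
  rw [PowerSeries.coeff_C_mul, PowerSeries.coeff_mk, PowerSeries.coeff_mul,
    Finset.Nat.sum_antidiagonal_eq_sum_range_succ_mk] at this
  rw [this]
  refine Finset.sum_congr rfl fun k _ ↦ ?_
  simp [b, bernoulliPowerSeries, PowerSeries.coeff_rescale]


lemma sum_range_two_mul_add_one_of_odd_eq_zero {M : ℕ} {f : ℕ → ℂ}
    (hf : ∀ j < M, f (2 * j + 1) = 0) :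
    ∑ k ∈ Finset.range (2 * M + 1), f k = ∑ j ∈ Finset.range (M + 1), f (2 * j) := by
  induction M with
  | zero => simp
  | succ M ih =>
    rw [show 2 * (M + 1) + 1 = 2 * M + 1 + 1 + 1 by ring, Finset.sum_range_succ,
      Finset.sum_range_succ, ih fun j hj ↦ hf j (by lia), hf M (by lia),
      Finset.sum_range_succ _ (M + 1)]
    ring_nf

lemma bernoulli_two_mul_div_factorial_eq (j : ℕ) :
    (bernoulli (2 * j) / (2 * j).factorial : ℂ)
      = -2 * riemannZeta (2 * j) / (2 * π * I) ^ (2 * j) := by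
  have hpi : (π : ℂ) ≠ 0 := by exact_mod_cast Real.pi_ne_zero
  have hI : (I : ℂ) ^ (2 * j) = (-1) ^ j := by rw [pow_mul, I_sq]
  have h1 : ((-1 : ℂ) ^ j) ≠ 0 := pow_ne_zero _ (by norm_num)
  have h2 : (2 : ℂ) ^ (2 * j - 1 : ℤ) = 2 ^ (2 * j) / 2 := by
    rw [zpow_sub₀ two_ne_zero, zpow_one]
    norm_cast
  rw [riemannZeta_two_mul_nat', mul_pow, mul_pow, hI, h2]
  have hf : ((2 * j).factorial : ℂ) ≠ 0 := by exact_mod_cast Nat.factorial_ne_zero _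
  field_simp
  ring

/-- Double Bernoulli numbers of even index in terms of even zeta values. -/
lemma IsMultBernoulli.mul_div_factorial_eq_riemannZeta {τ : ℂ} {B : ℕ → ℂ}
    (hB : IsMultBernoulli 2 0 ![τ, 1] B) {N : ℕ} (hN : 1 ≤ N) :
    τ * (B (2 * N + 2) / (2 * N + 2).factorial) = 4 / (2 * π * I) ^ (2 * N + 2) *
      (-(1 / 2) * (1 + τ ^ (2 * N + 2)) * riemannZeta (2 * N + 2)
        + τ ^ 2 * ∑ j ∈ Finset.range N,
          τ ^ (2 * j) * (riemannZeta (2 * (N - j : ℕ)) * riemannZeta (2 * (j + 1 : ℕ)))) := by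
  have hodd : ∀ j < N + 1, τ ^ (2 * j + 1) *
      (bernoulli (2 * j + 1) / (2 * j + 1).factorial : ℂ) *
      (bernoulli (2 * N + 2 - (2 * j + 1)) / (2 * N + 2 - (2 * j + 1)).factorial : ℂ) = 0 := by
    intro j hj
    rcases Nat.eq_zero_or_pos j with rfl | hj0
    · rw [bernoulli_eq_zero_of_odd (n := 2 * N + 2 - (2 * 0 + 1)) ⟨N, by lia⟩ (by lia)]
      simp
    · rw [bernoulli_eq_zero_of_odd (n := 2 * j + 1) ⟨j, rfl⟩ (by lia)]
      simp
  have heven : ∀ j ∈ Finset.range (N + 2), τ ^ (2 * j) *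
      (bernoulli (2 * j) / (2 * j).factorial : ℂ) *
      (bernoulli (2 * N + 2 - 2 * j) / (2 * N + 2 - 2 * j).factorial : ℂ)
      = 4 / (2 * π * I) ^ (2 * N + 2) *
        (τ ^ (2 * j) * (riemannZeta (2 * (N + 1 - j : ℕ)) * riemannZeta (2 * j))) := by
    intro j hj
    have hj' := Finset.mem_range.mp hj
    obtain ⟨k, hk⟩ := Nat.exists_eq_add_of_le (show j ≤ N + 1 by lia)
    rw [show 2 * N + 2 - 2 * j = 2 * k by lia, show N + 1 - j = k by lia,
      show 2 * N + 2 = 2 * j + 2 * k by lia, bernoulli_two_mul_div_factorial_eq,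
      bernoulli_two_mul_div_factorial_eq, pow_add]
    have := Complex.two_pi_I_ne_zero
    field_simp
    ring
  rw [hB.mul_div_factorial_eq, show 2 * N + 2 + 1 = 2 * (N + 1) + 1 by ring,
    sum_range_two_mul_add_one_of_odd_eq_zero hodd, Finset.sum_congr rfl heven, ← Finset.mul_sum,
    Finset.sum_range_succ, Finset.sum_range_succ']
  congr 1
  have hs : ∑ j ∈ Finset.range N, τ ^ (2 * (j + 1)) *
        (riemannZeta (2 * (N + 1 - (j + 1) : ℕ)) * riemannZeta (2 * (j + 1 : ℕ)))
      = τ ^ 2 * ∑ j ∈ Finset.range N,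
          τ ^ (2 * j) * (riemannZeta (2 * (N - j : ℕ)) * riemannZeta (2 * (j + 1 : ℕ))) := by
    rw [Finset.mul_sum]
    refine Finset.sum_congr rfl fun j _ ↦ ?_
    rw [Nat.add_sub_add_right]
    ring
  rw [hs]
  have hz : (2 * (N + 1 : ℕ) : ℂ) = 2 * N + 2 := by push_cast; ring
  simp only [Nat.sub_self, Nat.sub_zero, Nat.cast_zero, mul_zero, riemannZeta_zero, hz]
  ring

/-- Ramanujan's formula. -/
theorem ramanujan_formula (τ : ℂ) (hτ : 0 < τ.im) (N : ℕ) (hN : 1 ≤ N)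
    (B : ℕ → ℂ) (hB : IsMultBernoulli 2 0 ![τ, 1] B) :
    (1 / 2) * riemannZeta (2 * N + 1)
      + ∑' n : ℕ, (1 / ((n : ℂ) + 1) ^ (2 * N + 1)) *
          (Complex.exp (2 * π * I * ((n : ℂ) + 1) * τ)
            / (1 - Complex.exp (2 * π * I * ((n : ℂ) + 1) * τ)))
    = τ ^ (2 * N) *
        ((1 / 2) * riemannZeta (2 * N + 1)
          + ∑' n : ℕ, (1 / ((n : ℂ) + 1) ^ (2 * N + 1)) *
              (Complex.exp (-(2 * π * I * ((n : ℂ) + 1)) / τ)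
                / (1 - Complex.exp (-(2 * π * I * ((n : ℂ) + 1)) / τ))))
      + (1 / 2) * (2 * π * I) ^ (2 * N + 1) / ((2 * N + 2).factorial : ℂ) * B (2 * N + 2) := by
  have hτ0 : τ ≠ 0 := by rintro rfl; simp at hτ
  have him : 0 < (-1 / τ).im := by
    rw [neg_div, one_div, Complex.neg_im, Complex.inv_im, neg_div, neg_neg]
    exact div_pos hτ (Complex.normSq_pos.mpr hτ0)
  have hexp : ∀ n : ℕ, -(2 * π * I * ((n : ℂ) + 1)) / τ = 2 * π * I * ((n : ℂ) + 1) * (-1 / τ) :=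
    fun n ↦ by ring
  have hBern := hB.mul_div_factorial_eq_riemannZeta hN
  have hsum := lambert_sub_eq_sum_riemannZeta hN τ hτ
  simp only [hexp]
  rw [half_riemannZeta_add_tsum_eq hN τ hτ, half_riemannZeta_add_tsum_eq hN (-1 / τ) him]
  rw [mul_comm τ, ← eq_div_iff hτ0] at hBern
  rw [← eq_sub_iff_add_eq] at hsum
  rw [div_mul_eq_mul_div _ _ (B _), mul_div_assoc _ (B _), hBern, hsum]
  have hpi : (π : ℂ) ≠ 0 := by exact_mod_cast Real.pi_ne_zero
  have hI : (2 * π * I : ℂ) ^ (2 * N + 2) = (2 * π * I) ^ (2 * N + 1) * (2 * π * I) := pow_succ _ _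
  have hI0 : (2 * π * I : ℂ) ^ (2 * N + 1) ≠ 0 := pow_ne_zero _ Complex.two_pi_I_ne_zero
  rw [hI]
  generalize (2 * π * I : ℂ) ^ (2 * N + 1) = c at *
  generalize (∑' p : ℕ × ℕ, 1 / ((p.1 : ℂ) + 1) ^ (2 * N) *
          (1 / (((p.1 : ℂ) + 1) ^ 2 * (-1 / τ) ^ 2 - ((p.2 : ℂ) + 1) ^ 2))) = D
  generalize (∑ j ∈ Finset.range N, τ ^ (2 * j) *
    (riemannZeta (2 * (N - j : ℕ)) * riemannZeta (2 * (j + 1 : ℕ)))) = S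
  field_simp
  rw [I_sq]
  ring
end

section
/- (Eisenstein/Lambert series inversion) For τ in the upper half-plane and any positive integer N: Σ_{n≥1} n^{2N−1} e^{−2πin/τ}/(1 − e^{−2πin/τ}) − B_{2N}/(4N) = τ^{2N} (Σ_{n≥1} n^{2N−1} e^{2πinτ}/(1 − e^{2πinτ}) − B_{2N}/(4N)) − (τ/(4πi)) δ_{1,N}, where B_{2N} is the 2N-th Bernoulli number and δ_{1,N} is 1 if N = 1 and 0 otherwise. -/
open Complex Real

section UpperHalfPlaneLemmas

open UpperHalfPlane hiding I
open EisensteinSeries ModularForm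
open scoped UpperHalfPlane

/-- The Lambert series of weight `k + 1` at a point of the upper half-plane, written as a power
series in `exp (2πiz)` with divisor-sum coefficients. -/
lemma tsum_lambert_eq_tsum_sigma (k : ℕ) (z : ℍ) :
    ∑' n : ℕ, ((n : ℂ) + 1) ^ k * (Complex.exp (2 * π * I * ((n : ℂ) + 1) * z)
        / (1 - Complex.exp (2 * π * I * ((n : ℂ) + 1) * z)))
      = ∑' n : ℕ+, (ArithmeticFunction.sigma k n : ℂ) *
          Complex.exp (2 * π * I * z) ^ (n : ℕ) := by
  rw [← tsum_pow_div_one_sub_eq_tsum_sigma (norm_exp_two_pi_I_lt_one z),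
    tsum_pnat_eq_tsum_succ (f := fun n : ℕ ↦ (n : ℂ) ^ k * Complex.exp (2 * π * I * z) ^ n /
      (1 - Complex.exp (2 * π * I * z) ^ n))]
  refine tsum_congr fun n ↦ ?_
  rw [← Complex.exp_nat_mul]
  push_cast
  rw [mul_div_assoc, show 2 * π * I * ((n : ℂ) + 1) * z = (n + 1) * (2 * π * I * z) by ring]

lemma bernoulli_two_mul_ne_zero {N : ℕ} (hN : N ≠ 0) : bernoulli (2 * N) ≠ 0 := by
  intro h
  have hζ := riemannZeta_two_mul_nat hN
  rw [h] at hζ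
  refine riemannZeta_ne_zero_of_one_lt_re (s := 2 * N) ?_ (by simpa using hζ)
  norm_cast
  omega

lemma E_inv_neg {k : ℕ} (hk : 3 ≤ k) (z : ℍ) :
    E hk (.mk (-z : ℂ)⁻¹ z.im_inv_neg_coe_pos) = (z : ℂ) ^ k * E hk z := by
  have h := congrFun ((E hk).slash_action_eq' _ ⟨ModularGroup.S, rfl⟩) z
  change (⇑(E hk) ∣[(k : ℤ)] ModularGroup.S) z = E hk z at h
  rw [SlashInvariantForm.slash_S_apply, zpow_neg, ← div_eq_mul_inv,
    div_eq_iff (zpow_ne_zero _ (ne_zero z)), zpow_natCast] at h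
  rw [h, mul_comm]

lemma E2_inv_neg (z : ℍ) :
    E2 (.mk (-z : ℂ)⁻¹ z.im_inv_neg_coe_pos) = (z : ℂ) ^ 2 * E2 z - 6 * I / π * z := by
  have h := congrFun (E2_slash_action ModularGroup.S) z
  have hz := ne_zero z
  have hπ : (π : ℂ) ≠ 0 := ofReal_ne_zero.mpr Real.pi_ne_zero
  rw [SlashInvariantForm.slash_S_apply, Pi.sub_apply, Pi.smul_apply, D2_S, riemannZeta_two,
    smul_eq_mul, zpow_neg, ← div_eq_mul_inv, div_eq_iff (by positivity)] at h
  rw [h]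
  field_simp

lemma lambert_sub_bernoulli_eq_E {N : ℕ} (hN : 3 ≤ 2 * N) (z : ℍ) :
    ∑' n : ℕ, ((n : ℂ) + 1) ^ (2 * N - 1) * (Complex.exp (2 * π * I * ((n : ℂ) + 1) * z)
        / (1 - Complex.exp (2 * π * I * ((n : ℂ) + 1) * z))) - (bernoulli (2 * N) : ℂ) / (4 * N)
      = -((bernoulli (2 * N) : ℂ) / (4 * N)) * E hN z := by
  have hB : (bernoulli (2 * N) : ℂ) ≠ 0 := mod_cast bernoulli_two_mul_ne_zero (by omega)
  have hN0 : (N : ℂ) ≠ 0 := mod_cast (by omega : N ≠ 0)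
  rw [tsum_lambert_eq_tsum_sigma, q_expansion_bernoulli hN (even_two_mul N)]
  simp_rw [zpow_natCast]
  push_cast
  field_simp
  ring

lemma lambert_sub_bernoulli_eq_E2 (z : ℍ) :
    ∑' n : ℕ, ((n : ℂ) + 1) ^ (2 * 1 - 1) * (Complex.exp (2 * π * I * ((n : ℂ) + 1) * z)
        / (1 - Complex.exp (2 * π * I * ((n : ℂ) + 1) * z))) - (bernoulli (2 * 1) : ℂ) / (4 * (1 : ℕ))
      = -(1 / 24) * E2 z := by
  rw [tsum_lambert_eq_tsum_sigma, E2_eq_tsum_cexp, mul_one, bernoulli_two]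
  push_cast
  ring

end UpperHalfPlaneLemmas

/-- Inversion formula for the Eisenstein/Lambert series of weight `2N`, with the
anomalous term `−τ/(4πi)` appearing exactly when `N = 1`.  `bernoulli (2N)` is the
classical Bernoulli number `B_{2N}`. -/
theorem lambert_inversion (τ : ℂ) (hτ : 0 < τ.im) (N : ℕ) (hN : 1 ≤ N) :
    (∑' n : ℕ, ((n : ℂ) + 1) ^ (2 * N - 1) *
        (Complex.exp (-(2 * π * I * ((n : ℂ) + 1)) / τ)
          / (1 - Complex.exp (-(2 * π * I * ((n : ℂ) + 1)) / τ))))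
      - (bernoulli (2 * N) : ℂ) / (4 * N)
    = τ ^ (2 * N) *
        ((∑' n : ℕ, ((n : ℂ) + 1) ^ (2 * N - 1) *
            (Complex.exp (2 * π * I * ((n : ℂ) + 1) * τ)
              / (1 - Complex.exp (2 * π * I * ((n : ℂ) + 1) * τ))))
          - (bernoulli (2 * N) : ℂ) / (4 * N))
      - (if N = 1 then τ / (4 * π * I) else 0) := by
  have hτ0 : τ ≠ 0 := fun h ↦ by simp [h] at hτ
  set z : UpperHalfPlane := ⟨τ, hτ⟩
  set w : UpperHalfPlane := .mk (-z : ℂ)⁻¹ z.im_inv_neg_coe_pos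
  have hwτ (n : ℕ) : -(2 * π * I * ((n : ℂ) + 1)) / τ = 2 * π * I * ((n : ℂ) + 1) * w := by
    change _ = 2 * π * I * ((n : ℂ) + 1) * (-τ)⁻¹
    field_simp
  simp_rw [hwτ]
  change _ = (z : ℂ) ^ (2 * N) * (∑' n : ℕ, ((n : ℂ) + 1) ^ (2 * N - 1) *
    (Complex.exp (2 * π * I * ((n : ℂ) + 1) * z)
      / (1 - Complex.exp (2 * π * I * ((n : ℂ) + 1) * z))) - _) - if N = 1 then (z : ℂ) / _ else 0
  obtain rfl | hN1 := eq_or_ne N 1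
  · rw [lambert_sub_bernoulli_eq_E2, lambert_sub_bernoulli_eq_E2, E2_inv_neg, if_pos rfl]
    have hπ : (π : ℂ) ≠ 0 := ofReal_ne_zero.mpr Real.pi_ne_zero
    field_simp
    linear_combination (24 * z : ℂ) * I_sq
  · have hN3 : 3 ≤ 2 * N := by omega
    rw [lambert_sub_bernoulli_eq_E hN3, lambert_sub_bernoulli_eq_E hN3, E_inv_neg,
      if_neg hN1]
    ring
end
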